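/- arXiv:2402.11539 — 2 statements merged into one kernel-verified Lean document; each statement's English description precedes it below -/
import Mathlib

section
/- Weak Brown–Deligne theorem for cyclotomic multiple zeta values: for every positive array (𝛆;𝔱) of weight w, the value ζ_A(𝛆;𝔱) is an A_N-linear combination of the values ζ_A(𝛜;𝔰) with 𝔰 ∈ T_w and 𝛜 ∈ Γ_N^{depth(𝔰)}. In particular, the set {ζ_A(𝛜;𝔰) : 𝔰 ∈ T_w, 𝛜 ∈ Γ_N^{depth(𝔰)}} spans CZ_{N,w} over K_N. -/
noncomputable section

open scoped Classical

namespace ZHPC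

variable (Fq : Type) [Field Fq] [Fintype Fq]

/-- `q`, the cardinality of the base finite field `𝔽_q`. -/
def qc : ℕ := Fintype.card Fq

/-- A fixed algebraic closure `𝔽̄_q` of `𝔽_q`. -/
abbrev Fb := AlgebraicClosure Fq

/-- The field `𝔽̄_q((1/θ))` of formal Laurent series in `1/θ` over `𝔽̄_q`, modeled as the
field of formal Laurent series in one variable, `θ` being the inverse of that variable. -/
abbrev Kinf := LaurentSeries (Fb Fq)

/-- The embedding of the constants `𝔽̄_q → 𝔽̄_q((1/θ))`. -/
def cst : Fb Fq →+* Kinf Fq := HahnSeries.C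

/-- The element `θ`. -/
def theta : Kinf Fq := HahnSeries.single (-1 : ℤ) 1

/-- `ℓ_d = ∏_{i=1}^{d} (θ - θ^{q^i})`, with `ℓ_0 = 1`. -/
def ell (d : ℕ) : Kinf Fq := ∏ i ∈ Finset.Icc 1 d, (theta Fq - theta Fq ^ qc Fq ^ i)

/-- Arrays `(𝛆;𝔰)` of some depth `n`. -/
structure PArr (F : Type) where
  depth : ℕ
  s : Fin depth → ℕ
  eps : Fin depth → F

namespace PArr

variable {F : Type}

/-- A *positive array* for level `N`: all entries `sᵢ` are positive integers and all the
characters `εᵢ` are `N`-th roots of unity. -/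
def Positive [Monoid F] (N : ℕ) (A : PArr F) : Prop := (∀ i, 0 < A.s i) ∧ ∀ i, A.eps i ^ N = 1

/-- The weight `w(𝔰) = s₁ + ⋯ + s_n`. -/
def wt (A : PArr F) : ℕ := ∑ i, A.s i

/-- The `i`-th entry of `𝔰` (`0`-indexed), with value `0` beyond the depth. -/
def sAt (A : PArr F) (i : ℕ) : ℕ := if h : i < A.depth then A.s ⟨i, h⟩ else 0

/-- The partial sums `s₁ + ⋯ + s_i` (entries beyond the depth being `0`). -/
def psum (A : PArr F) (i : ℕ) : ℕ := ∑ j ∈ Finset.range i, A.sAt j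

/-- The character `χ(𝛆) = ε₁ ⋯ ε_n`. -/
def chi [CommMonoid F] (A : PArr F) : F := ∏ i, A.eps i

end PArr

/-- The Carlitz multiple polylogarithm at roots of unity
`Li(𝛆;𝔰) = Σ_{d₁ > ⋯ > d_n ≥ 0} ε₁^{d₁}⋯ε_n^{d_n} / (ℓ_{d₁}^{s₁}⋯ℓ_{d_n}^{s_n})`. -/
def Li (A : PArr (Fb Fq)) : Kinf Fq :=
  ∑' d : {f : Fin A.depth → ℕ // StrictAnti f},
    ∏ i, cst Fq (A.eps i ^ d.1 i) / ell Fq (d.1 i) ^ A.s i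

/-- `Si_d(𝛆;𝔰)`: same summand as `Li`, over decreasing tuples with `d₁ = d`. -/
def Sid (d : ℤ) (A : PArr (Fb Fq)) : Kinf Fq :=
  ∑' f : {f : Fin A.depth → ℕ // StrictAnti f ∧ ∀ i : Fin A.depth, i.val = 0 → (f i : ℤ) = d},
    ∏ i, cst Fq (A.eps i ^ f.1 i) / ell Fq (f.1 i) ^ A.s i

/-- `Si_{<d}(𝛆;𝔰)`: same summand as `Li`, over decreasing tuples with `d > d₁`. -/
def SidLt (d : ℤ) (A : PArr (Fb Fq)) : Kinf Fq :=
  ∑' f : {f : Fin A.depth → ℕ // StrictAnti f ∧ ∀ i : Fin A.depth, (f i : ℤ) < d},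
    ∏ i, cst Fq (A.eps i ^ f.1 i) / ell Fq (f.1 i) ^ A.s i

/-- The value at `θ` of the monic polynomial `θ^e + Σ_{j<e} c_j θ^j ∈ A = 𝔽_q[θ]`. -/
def monicVal (e : ℕ) (c : Fin e → Fq) : Kinf Fq :=
  theta Fq ^ e + ∑ j, cst Fq (algebraMap Fq (Fb Fq) (c j)) * theta Fq ^ (j : ℕ)

/-- The power sum `S_d(𝛆;𝔰)`, a sum over tuples of monic polynomials `a₁, …, a_n ∈ A₊`
with `d = deg a₁ > ⋯ > deg a_n ≥ 0`; a monic polynomial of degree `e` is encoded by its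
tuple of lower coefficients `c : Fin e → Fq`. -/
def Sd (d : ℤ) (A : PArr (Fb Fq)) : Kinf Fq :=
  ∑' e : {f : Fin A.depth → ℕ // StrictAnti f ∧ ∀ i : Fin A.depth, i.val = 0 → (f i : ℤ) = d},
    ∑ c : (∀ i, Fin (e.1 i) → Fq),
      ∏ i, cst Fq (A.eps i ^ e.1 i) / monicVal Fq (e.1 i) (c i) ^ A.s i

/-- The `N`-th cyclotomic multiple zeta value `ζ_A(𝛆;𝔰) = Σ_{d ≥ 0} S_d(𝛆;𝔰)`. -/
def zetaA (A : PArr (Fb Fq)) : Kinf Fq := ∑' d : ℕ, Sd Fq (d : ℤ) A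

/-- The cyclotomic field `k_N = 𝔽_q(ζ_N) ⊆ 𝔽̄_q`. -/
def kN (N : ℕ) : Subfield (Fb Fq) :=
  Subfield.closure (Set.range (algebraMap Fq (Fb Fq)) ∪ {x | x ^ N = 1})

/-- The field `K_N = k_N(θ)`, as a subfield of `𝔽̄_q((1/θ))`. -/
def KNf (N : ℕ) : Subfield (Kinf Fq) :=
  Subfield.closure ((cst Fq '' (kN Fq N : Set (Fb Fq))) ∪ {theta Fq})

/-- The ring `A_N = k_N[θ]`, as a subring of `𝔽̄_q((1/θ))`. -/
def AN (N : ℕ) : Subring (Kinf Fq) :=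
  Subring.closure ((cst Fq '' (kN Fq N : Set (Fb Fq))) ∪ {theta Fq})

/-- `CZ_{N,w}`: the `K_N`-span of the `N`-th cyclotomic multiple zeta values of weight `w`. -/
def CZ (N w : ℕ) : Submodule (KNf Fq N) (Kinf Fq) :=
  Submodule.span (KNf Fq N) {x | ∃ A : PArr (Fb Fq), A.Positive N ∧ A.wt = w ∧ x = zetaA Fq A}

/-- `CL_{N,w}`: the `K_N`-span of the CMPL's at `N`-th roots of unity of weight `w`. -/
def CL (N w : ℕ) : Submodule (KNf Fq N) (Kinf Fq) :=
  Submodule.span (KNf Fq N) {x | ∃ A : PArr (Fb Fq), A.Positive N ∧ A.wt = w ∧ x = Li Fq A}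

/-- The index set of pairs `(𝔰,𝛆)` with `𝔰 ∈ S_w` and `𝛆 ∈ Γ_N^{depth 𝔰}`: positive arrays
of weight `w` with `q ∤ sᵢ` for all `i`. -/
def SwIdx (N w : ℕ) : Type :=
  {A : PArr (Fb Fq) // A.Positive N ∧ 0 < A.depth ∧ A.wt = w ∧ ∀ i, ¬ qc Fq ∣ A.s i}

/-- Membership of the tuple `𝔰` in `T_w`: `𝔰` is a nonempty tuple of weight `w` with
`s₁, …, s_{n-1} ≤ q` and `s_n < q`. -/
def InTw {F : Type} (Q w : ℕ) (A : PArr F) : Prop :=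
  0 < A.depth ∧ A.wt = w ∧
    (∀ i : Fin A.depth, i.val < A.depth - 1 → A.s i ≤ Q) ∧
    ∀ i : Fin A.depth, i.val = A.depth - 1 → A.s i < Q

set_option synthInstance.maxHeartbeats 1000000

namespace Abs

section basic

set_option linter.unusedSectionVars false

variable {F L : Type} [Field F] [Field L]

def cs (R : Subring L) : (ℕ → L) →ₗ[R] (ℕ → L) where
  toFun f := fun d => ∑ j ∈ Finset.range d, f j
  map_add' f g := by funext d; simp [Finset.sum_add_distrib]
  map_smul' r f := by funext d; simp [Finset.smul_sum]

def lm (R : Subring L) (g : ℕ → L) : (ℕ → L) →ₗ[R] (ℕ → L) where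
  toFun f := g * f
  map_add' f h := by rw [mul_add]
  map_smul' r f := by simp

def sh (R : Subring L) : (ℕ → L) →ₗ[R] (ℕ → L) where
  toFun f := fun d => f (d + 1)
  map_add' f g := by funext d; simp
  map_smul' r f := by funext d; simp

def ps (f : ℕ → L) : ℕ → L := fun d => ∑ j ∈ Finset.range d, f j

theorem cs_apply (R : Subring L) (f : ℕ → L) : cs R f = ps f := rfl
theorem lm_apply (R : Subring L) (g f : ℕ → L) : lm R g f = g * f := rfl
theorem sh_apply (R : Subring L) (f : ℕ → L) (d : ℕ) : sh R f d = f (d+1) := rfl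

theorem ps_mul (f g : ℕ → L) : ps f * ps g = ps (f * ps g + g * ps f + f * g) := by
  funext d
  induction d with
  | zero => simp [ps]
  | succ d ih =>
    simp only [ps, Pi.mul_apply, Pi.add_apply, Finset.sum_range_succ] at ih ⊢
    rw [← ih]; ring

def GG {α : Type} (m : α → ℕ → L) : List α → ℕ → L
  | [] => 1
  | x :: u => ps (m x * GG m u)

def WW {α : Type} (m : α → ℕ → L) : List α → ℕ → L
  | [] => 0
  | x :: u => m x * GG m u

theorem GG_cons {α : Type} (m : α → ℕ → L) (x : α) (u : List α) :
    GG m (x :: u) = ps (WW m (x :: u)) := rfl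

theorem WW_cons {α : Type} (m : α → ℕ → L) (x : α) (u : List α) :
    WW m (x :: u) = m x * GG m u := rfl

def Val (N : ℕ) (z : List (ℕ × F)) : Prop := ∀ x ∈ z, 0 < x.1 ∧ x.2 ^ N = 1

def wtl (z : List (ℕ × F)) : ℕ := (z.map Prod.fst).sum

theorem Val_cons {N : ℕ} {x : ℕ × F} {z : List (ℕ × F)} :
    Val N (x :: z) ↔ (0 < x.1 ∧ x.2 ^ N = 1) ∧ Val N z := by
  simp [Val]

theorem Val_nil {N : ℕ} : Val N ([] : List (ℕ × F)) := by simp [Val]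

theorem wtl_cons (x : ℕ × F) (z : List (ℕ × F)) : wtl (x :: z) = x.1 + wtl z := by simp [wtl]
theorem wtl_nil : wtl ([] : List (ℕ × F)) = 0 := by simp [wtl]

theorem len_le_wtl {N : ℕ} {z : List (ℕ × F)} (h : Val N z) : z.length ≤ wtl z := by
  induction z with
  | nil => simp
  | cons x z ih =>
    rw [Val_cons] at h
    have := ih h.2
    rw [wtl_cons, List.length_cons]; omega

variable (N : ℕ) (R : Subring L) (m : ℕ × F → ℕ → L)

def GS (w n : ℕ) : Submodule R (ℕ → L) :=
  Submodule.span R {f | ∃ z, Val N z ∧ wtl z = w ∧ n ≤ z.length ∧ f = GG m z}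

def WS (w n : ℕ) : Submodule R (ℕ → L) :=
  Submodule.span R {f | ∃ x z, Val N (x :: z) ∧ wtl (x :: z) = w ∧ n ≤ (x :: z).length ∧
    f = WW m (x :: z)}

def ES (w n : ℕ) : Submodule R (ℕ → L) :=
  Submodule.span R {f | ∃ ε T, Val N ((1, ε) :: T) ∧ wtl ((1, ε) :: T) = w ∧
    n ≤ ((1, ε) :: T).length ∧ f = WW m ((1, ε) :: T)}

variable {N R m}

theorem GS_mono {w n n' : ℕ} (h : n' ≤ n) : GS N R m w n ≤ GS N R m w n' := by
  apply Submodule.span_mono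
  rintro f ⟨z, h1, h2, h3, h4⟩
  exact ⟨z, h1, h2, h.trans h3, h4⟩

theorem WS_mono {w n n' : ℕ} (h : n' ≤ n) : WS N R m w n ≤ WS N R m w n' := by
  apply Submodule.span_mono
  rintro f ⟨x, z, h1, h2, h3, h4⟩
  exact ⟨x, z, h1, h2, h.trans h3, h4⟩

theorem ES_mono {w n n' : ℕ} (h : n' ≤ n) : ES N R m w n ≤ ES N R m w n' := by
  apply Submodule.span_mono
  rintro f ⟨x, z, h1, h2, h3, h4⟩
  exact ⟨x, z, h1, h2, h.trans h3, h4⟩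

theorem ES_le_WS {w n : ℕ} : ES N R m w n ≤ WS N R m w n := by
  apply Submodule.span_mono
  rintro f ⟨x, z, h1, h2, h3, h4⟩
  exact ⟨_, z, h1, h2, h3, h4⟩

theorem GG_mem {z : List (ℕ × F)} (h : Val N z) : GG m z ∈ GS N R m (wtl z) z.length :=
  Submodule.subset_span ⟨z, h, rfl, le_rfl, rfl⟩

theorem WW_mem {x} {z : List (ℕ × F)} (h : Val N (x :: z)) :
    WW m (x :: z) ∈ WS N R m (wtl (x :: z)) (x :: z).length :=
  Submodule.subset_span ⟨x, z, h, rfl, le_rfl, rfl⟩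

/-- span elimination through a linear map -/
theorem span_elim {s : Set (ℕ → L)} {T : Submodule R (ℕ → L)} (φ : (ℕ → L) →ₗ[R] (ℕ → L))
    (h : ∀ f ∈ s, φ f ∈ T) {f : ℕ → L} (hf : f ∈ Submodule.span R s) : φ f ∈ T := by
  have : Submodule.span R s ≤ T.comap φ := Submodule.span_le.2 h
  exact this hf

theorem m_mul_GS {w n : ℕ} {x : ℕ × F} (hx : 0 < x.1 ∧ x.2 ^ N = 1) {h : ℕ → L}
    (hh : h ∈ GS N R m w n) : m x * h ∈ WS N R m (x.1 + w) (n + 1) := by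
  refine span_elim (lm R (m x)) ?_ hh
  rintro f ⟨z, h1, h2, h3, rfl⟩
  refine Submodule.subset_span ⟨x, z, Val_cons.2 ⟨hx, h1⟩, by rw [wtl_cons, h2], by simpa using h3, rfl⟩

theorem m_mul_ES {w n : ℕ} {ε : F} (hx : ε ^ N = 1) {h : ℕ → L}
    (hh : h ∈ GS N R m w n) : m (1, ε) * h ∈ ES N R m (1 + w) (n + 1) := by
  refine span_elim (lm R (m (1, ε))) ?_ hh
  rintro f ⟨z, h1, h2, h3, rfl⟩
  refine Submodule.subset_span ⟨ε, z, Val_cons.2 ⟨⟨one_pos, hx⟩, h1⟩, by rw [wtl_cons, h2], by simpa using h3, rfl⟩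

theorem ps_WS {w n : ℕ} {f : ℕ → L} (hf : f ∈ WS N R m w n) : ps f ∈ GS N R m w n := by
  refine span_elim (cs R) ?_ hf
  rintro f ⟨x, z, h1, h2, h3, rfl⟩
  exact Submodule.subset_span ⟨x :: z, h1, h2, h3, rfl⟩

/-- multiplicative letters -/
def Mult (m : ℕ × F → ℕ → L) : Prop := ∀ x y, m x * m y = m (x.1 + y.1, x.2 * y.2)

theorem stuffle (hm : Mult m) : ∀ (k : ℕ) (u v : List (ℕ × F)), u.length + v.length ≤ k →
    Val N u → Val N v →
    GG m u * GG m v ∈ GS N R m (wtl u + wtl v) (max u.length v.length) := by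
  intro k
  induction k with
  | zero =>
    intro u v h hu hv
    have h1 : u = [] := List.length_eq_zero_iff.1 (by omega)
    have h2 : v = [] := List.length_eq_zero_iff.1 (by omega)
    subst h1 h2
    have := GG_mem (R := R) (m := m) hu
    simpa [GG, wtl] using this
  | succ k ih =>
    intro u v h hu hv
    match u, v with
    | [], v =>
      have := GG_mem (R := R) (m := m) hv
      simpa [GG, wtl] using this
    | u, [] =>
      have := GG_mem (R := R) (m := m) hu
      simpa [GG, wtl] using this
    | x :: u, y :: v =>
      simp only [List.length_cons] at h
      have hx := (Val_cons.1 hu).1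
      have hy := (Val_cons.1 hv).1
      have hu' := (Val_cons.1 hu).2
      have hv' := (Val_cons.1 hv).2
      have e1 := m_mul_GS hx (ih u (y :: v) (by simp; omega) hu' hv)
      have e2 := m_mul_GS hy (ih (x :: u) v (by simp; omega) hu hv')
      have hxy : 0 < (x.1 + y.1, x.2 * y.2).1 ∧ (x.1 + y.1, x.2 * y.2).2 ^ N = 1 := by
        refine ⟨by simp; omega, by simp [mul_pow, hx.2, hy.2]⟩
      have e3 := m_mul_GS hxy (ih u v (by omega) hu' hv')
      have key : GG m (x :: u) * GG m (y :: v) = ps (m x * (GG m u * GG m (y :: v)) +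
          m y * (GG m (x :: u) * GG m v) + m (x.1 + y.1, x.2 * y.2) * (GG m u * GG m v)) := by
        rw [← hm]
        conv_lhs => rw [GG_cons, GG_cons, ps_mul]
        rw [← GG_cons, ← GG_cons, WW_cons, WW_cons]
        congr 1
        ring
      rw [key]
      apply ps_WS
      simp only [wtl_cons, List.length_cons] at e1 e2 e3 ⊢
      refine add_mem (add_mem ?_ ?_) ?_
      · convert WS_mono ?_ e1 using 2
        · ring
        · omega
      · convert WS_mono ?_ e2 using 2
        · ring
        · omega
      · convert WS_mono ?_ e3 using 2
        · ring
        · omega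

theorem GS_mul_GG (hm : Mult m) {w n : ℕ} {h : ℕ → L} (hh : h ∈ GS N R m w n)
    {u : List (ℕ × F)} (hu : Val N u) :
    GG m u * h ∈ GS N R m (wtl u + w) (max u.length n) := by
  refine span_elim (lm R (GG m u)) ?_ hh
  rintro f ⟨z, h1, h2, h3, rfl⟩
  have := stuffle (R := R) hm _ u z le_rfl hu h1
  rw [lm_apply, ← h2]
  refine GS_mono ?_ this
  omega

theorem GS_mul (hm : Mult m) {w n w' n' : ℕ} {h h' : ℕ → L} (hh : h ∈ GS N R m w n)
    (hh' : h' ∈ GS N R m w' n') :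
    h * h' ∈ GS N R m (w + w') (max n n') := by
  rw [mul_comm]
  refine span_elim (lm R h') ?_ hh
  rintro f ⟨z, h1, h2, h3, rfl⟩
  have := GS_mul_GG hm hh' h1
  rw [lm_apply, ← h2, mul_comm]
  refine GS_mono ?_ this
  omega

theorem WS_mul_GS (hm : Mult m) {w n w' n' : ℕ} {f h' : ℕ → L} (hh : f ∈ WS N R m w n)
    (hh' : h' ∈ GS N R m w' n') :
    f * h' ∈ WS N R m (w + w') 1 := by
  rw [mul_comm]
  refine span_elim (lm R h') ?_ hh
  rintro f ⟨x, z, h1, h2, h3, rfl⟩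
  have hz := (Val_cons.1 h1)
  have := m_mul_GS hz.1 (GS_mul hm (GG_mem hz.2) hh')
  rw [lm_apply, ← h2, mul_comm, WW_cons, mul_assoc, wtl_cons, add_assoc]
  exact WS_mono (by omega) this

theorem WS_mul_WS (hm : Mult m) {w n w' n' : ℕ} {f g : ℕ → L} (hf : f ∈ WS N R m w n)
    (hg : g ∈ WS N R m w' n') :
    f * g ∈ WS N R m (w + w') 1 := by
  rw [mul_comm]
  refine span_elim (lm R g) ?_ hf
  rintro f ⟨x, z, h1, h2, h3, rfl⟩
  rw [lm_apply, mul_comm]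
  refine span_elim (lm R (WW m (x :: z))) ?_ hg
  rintro g ⟨y, z', h1', h2', h3', rfl⟩
  have hz := (Val_cons.1 h1)
  have hz' := (Val_cons.1 h1')
  have hxy : 0 < (x.1 + y.1, x.2 * y.2).1 ∧ (x.1 + y.1, x.2 * y.2).2 ^ N = 1 := by
    refine ⟨by have := hz.1.1; simp; omega, by simp [mul_pow, hz.1.2, hz'.1.2]⟩
  have := m_mul_GS hxy (GS_mul hm (GG_mem (R := R) (m := m) hz.2) (GG_mem hz'.2))
  rw [← hm] at this
  have e1 : WW m (x :: z) * WW m (y :: z') = m x * m y * (GG m z * GG m z') := by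
    rw [WW_cons, WW_cons]; ring
  have e2 : w + w' = (x.1 + y.1, x.2 * y.2).1 + (wtl z + wtl z') := by
    rw [← h2, ← h2', wtl_cons, wtl_cons]; simp only []; ring
  rw [lm_apply, e1, e2]
  exact WS_mono (by omega) this

end basic

end Abs
namespace Abs

section red

set_option linter.unusedSectionVars false

variable {F L : Type} [Field F] [Field L] (χ : F →+* L) (N : ℕ) (R : Subring L) (q : ℕ)
  (σ : ℕ → L)

def mm (x : ℕ × F) : ℕ → L := fun d => χ x.2 ^ d * σ d ^ x.1

theorem mm_mult : Mult (mm χ σ) := by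
  intro x y
  funext d
  simp only [mm, Pi.mul_apply, map_mul]
  ring

def Good (q : ℕ) : List (ℕ × F) → Prop
  | [] => False
  | x :: [] => x.1 < q
  | x :: y :: l => x.1 ≤ q ∧ Good q (y :: l)

theorem Good_cons {q : ℕ} {x : ℕ × F} {t : List (ℕ × F)} (hx : x.1 ≤ q) (ht : Good q t) :
    Good q (x :: t) := by
  match t, ht with
  | y :: l, ht => exact ⟨hx, ht⟩

def GdS (w : ℕ) : Submodule R (ℕ → L) :=
  Submodule.span R {f | ∃ t, Val N t ∧ Good q t ∧ wtl t = w ∧ f = WW (mm χ σ) t}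

variable {χ N R q σ}

theorem ES_zero {m : ℕ × F → ℕ → L} {w n : ℕ} (hn : 2 ≤ n) {g : ℕ → L}
    (hg : g ∈ ES N R m w n) : g 0 = 0 := by
  let φ : (ℕ → L) →ₗ[R] L := LinearMap.proj 0
  have : ES N R m w n ≤ (⊥ : Submodule R L).comap φ := by
    refine Submodule.span_le.2 ?_
    rintro f ⟨ε, T, h1, h2, h3, rfl⟩
    match T with
    | [] => simp at h3; omega
    | y :: l => simp [φ, WW_cons, GG_cons, ps]
  have h := this hg
  simp only [Submodule.mem_comap, Submodule.mem_bot] at h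
  exact h

theorem ps_sh {g : ℕ → L} (h0 : g 0 = 0) (d : ℕ) : ps (sh R g) d = ps g (d + 1) := by
  simp only [ps, sh_apply]
  rw [Finset.sum_range_succ' , h0, add_zero]

/-- prepending a letter to a good combination -/
theorem mm_GdS {w : ℕ} {x : ℕ × F} (hx : 0 < x.1 ∧ x.2 ^ N = 1) (hq : x.1 ≤ q) {t : ℕ → L}
    (ht : t ∈ GdS χ N R q σ w) : mm χ σ x * ps t ∈ GdS χ N R q σ (x.1 + w) := by
  refine span_elim (lm R (mm χ σ x) ∘ₗ cs R) ?_ ht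
  rintro f ⟨t, h1, h2, h3, rfl⟩
  match t, h2 with
  | y :: l, h2 =>
    exact Submodule.subset_span ⟨x :: y :: l, Val_cons.2 ⟨hx, h1⟩, Good_cons hq h2,
      by rw [wtl_cons, h3], rfl⟩

theorem mm_merge {w n p : ℕ} {η : F} (hη : η ^ N = 1) {g : ℕ → L}
    (hg : g ∈ ES N R (mm χ σ) w n) :
    mm χ σ (p, η) * g ∈ Submodule.span R {f | ∃ ε T, Val N ((p + 1, ε) :: T) ∧
      wtl ((p + 1, ε) :: T) = p + w ∧ n ≤ ((p + 1, ε) :: T).length ∧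
      f = WW (mm χ σ) ((p + 1, ε) :: T)} := by
  refine span_elim (lm R (mm χ σ (p, η))) ?_ hg
  rintro f ⟨ε, T, h1, h2, h3, rfl⟩
  have h := Val_cons.1 h1
  refine Submodule.subset_span ⟨η * ε, T, Val_cons.2 ⟨⟨by simp, ?_⟩, h.2⟩, ?_, ?_, ?_⟩
  · simpa [mul_pow, hη] using h.1.2
  · rw [← h2, wtl_cons, wtl_cons]; simp only []; ring
  · simpa using h3
  · rw [lm_apply, WW_cons, WW_cons, ← mul_assoc, mm_mult]

variable (χ N R q σ) in
def Red (w n : ℕ) : Submodule R (ℕ → L) :=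
  GdS χ N R q σ w ⊔ (ES N R (mm χ σ) w n).map (sh R)

theorem Red_mono {w n n' : ℕ} (h : n' ≤ n) {f : ℕ → L} (hf : f ∈ Red χ N R q σ w n) :
    f ∈ Red χ N R q σ w n' := by
  have : Red χ N R q σ w n ≤ Red χ N R q σ w n' :=
    sup_le_sup le_rfl (Submodule.map_mono (ES_mono h))
  exact this hf

theorem Red_left {w n : ℕ} {f : ℕ → L} (hf : f ∈ GdS χ N R q σ w) : f ∈ Red χ N R q σ w n :=
  Submodule.mem_sup_left hf

theorem Red_right {w n : ℕ} {f : ℕ → L} (hf : f ∈ (ES N R (mm χ σ) w n).map (sh R)) :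
    f ∈ Red χ N R q σ w n :=
  Submodule.mem_sup_right hf

theorem Red_elim {w n : ℕ} (hn : 2 ≤ n) {f : ℕ → L} (hf : f ∈ Red χ N R q σ w n) :
    ∃ t ∈ GdS χ N R q σ w, ∃ g ∈ ES N R (mm χ σ) w n, g 0 = 0 ∧ (f = fun d => t d + g (d + 1)) ∧
      ∀ d, ps f d = ps t d + ps g (d + 1) := by
  obtain ⟨t, ht, g', ⟨g, hg, rfl⟩, htg⟩ := Submodule.mem_sup.1 hf
  refine ⟨t, ht, g, hg, ES_zero hn hg, htg.symm, fun d => ?_⟩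
  rw [← ps_sh (R := R) (ES_zero hn hg) d, ← htg]
  simp [ps, Finset.sum_add_distrib]

variable (hχ : ∀ ε : F, ε ^ N = 1 → χ ε ∈ R) (hN : 0 < N) (hq : 2 ≤ q) (lam : L) (hlam : lam ∈ R)
  (hfund : ∀ d, σ d ^ q = lam * σ (d + 1) * ∑ j ∈ Finset.range (d + 1), σ j ^ (q - 1))

include hχ hN hq hlam hfund

theorem key_rel {w n : ℕ} {ε : F} (hε : ε ^ N = 1) {h : ℕ → L} (hh : h ∈ GS N R (mm χ σ) w n) :
    (fun d => mm χ σ (q, ε) d * h (d + 1)) ∈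
      (ES N R (mm χ σ) (q + w) (max 1 n + 1)).map (sh R) := by
  have hv : Val N [((q - 1 : ℕ), (1 : F))] := by
    refine Val_cons.2 ⟨⟨by simp; omega, by simp⟩, Val_nil⟩
  have h1 := m_mul_ES hε (GS_mul_GG (mm_mult χ σ) hh hv)
  have hε0 : ε ≠ 0 := by
    rintro rfl
    rw [zero_pow hN.ne'] at hε
    exact zero_ne_one hε
  have hc : lam * χ ε⁻¹ ∈ R := R.mul_mem hlam (hχ _ (by rw [inv_pow, hε, inv_one]))
  have h2 := Submodule.smul_mem _ (⟨_, hc⟩ : R) h1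
  refine ⟨(⟨_, hc⟩ : R) • (mm χ σ (1, ε) * (GG (mm χ σ) [(q - 1, 1)] * h)), ?_, ?_⟩
  · have e : ES N R (mm χ σ) (q + w) (max 1 n + 1) =
        ES N R (mm χ σ) (1 + (wtl [((q - 1 : ℕ), (1 : F))] + w)) (max [((q - 1 : ℕ), (1 : F))].length n + 1) := by
      simp only [wtl_cons, wtl_nil, List.length_cons, List.length_nil]
      congr 1
      omega
    rw [e]
    exact h2
  · funext d
    rw [sh_apply]
    simp only [Pi.smul_apply, Pi.mul_apply, Subring.smul_def, smul_eq_mul, mm,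
      GG, ps, map_one, one_pow, one_mul, mul_one, pow_one]
    rw [hfund d, map_inv₀, pow_succ]
    have : χ ε ≠ 0 := by simpa using hε0
    field_simp

theorem reduce : ∀ w k : ℕ, ∀ (x : ℕ × F) (z : List (ℕ × F)),
    Val N (x :: z) → wtl (x :: z) = w → w < z.length + 1 + k →
    WW (mm χ σ) (x :: z) ∈
      Red χ N R q σ w (z.length + 2) := by
  intro w
  induction w using Nat.strong_induction_on with
  | _ w ihw =>
  intro k
  induction k with
  | zero =>
    intro x z hv hwt hk
    have := len_le_wtl hv
    rw [List.length_cons] at this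
    omega
  | succ k ihk =>
    -- consequence of the induction hypothesis on depth
    have ihk' : ∀ n, w < n + 1 + k → ∀ f ∈ WS N R (mm χ σ) w (n + 1),
        f ∈ Red χ N R q σ w (n + 2) := by
      intro n hn f hf
      refine span_elim LinearMap.id ?_ hf
      rintro f ⟨x, z, h1, h2, h3, rfl⟩
      rw [List.length_cons] at h3
      have := ihk x z h1 h2 (by omega)
      exact Red_mono (by omega) this
    have big : ∀ (x : ℕ × F) (z : List (ℕ × F)), q ≤ x.1 →
        Val N (x :: z) → wtl (x :: z) = w → w < z.length + 1 + (k + 1) →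
        WW (mm χ σ) (x :: z) ∈
          Red χ N R q σ w (z.length + 2) := by
      rintro ⟨p, ε⟩ z hp hv hwt hk
      have hv' := Val_cons.1 hv
      simp only at hp hv'
      rw [wtl_cons] at hwt
      simp only at hwt
      rcases hp.eq_or_lt with rfl | hp
      · match z with
        | [] =>
          have h := key_rel hχ hN hq lam hlam hfund hv'.1.2 (GG_mem (R := R) (m := mm χ σ) Val_nil)
          rw [hwt] at h
          refine Red_right ?_
          simpa [WW, GG] using h
        | y :: l =>
          rw [wtl_cons] at hwt
          have hy := hv'.2 y (by simp)
          have h := ihw (wtl (y :: l)) (by rw [wtl_cons]; omega) (wtl (y :: l) + 1) y l hv'.2 rfl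
            (by omega)
          obtain ⟨t, ht, g, hg, hg0, htg, hps⟩ := Red_elim (by omega) h
          have e : WW (mm χ σ) ((q, ε) :: y :: l) = mm χ σ (q, ε) * ps t +
              fun d => mm χ σ (q, ε) d * ps g (d + 1) := by
            rw [WW_cons, GG_cons]
            funext d
            simp only [Pi.mul_apply, Pi.add_apply, hps d]
            ring
          rw [e]
          have hw' : w = q + wtl (y :: l) := by rw [wtl_cons]; omega
          refine add_mem (Red_left ?_) (Red_right ?_)
          · rw [hw']
            exact mm_GdS (x := (q, ε)) hv'.1 le_rfl ht
          · rw [hw']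
            refine Submodule.map_mono (ES_mono ?_)
              (key_rel hχ hN hq lam hlam hfund hv'.1.2 (ps_WS (ES_le_WS hg)))
            simp only [List.length_cons]
            omega
      · obtain ⟨s, rfl⟩ : ∃ s, p = q + s := ⟨p - q, by omega⟩
        have hvs : Val N ((s, (1 : F)) :: z) := Val_cons.2 ⟨⟨by simp; omega, by simp⟩, hv'.2⟩
        have h := key_rel hχ hN hq lam hlam hfund hv'.1.2 (GG_mem (R := R) (m := mm χ σ) hvs)
        have hvq : Val N ((q, ε) :: (s, (1 : F)) :: z) :=
          Val_cons.2 ⟨⟨by simp; omega, hv'.1.2⟩, hvs⟩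
        have h2 := WW_mem (R := R) (m := mm χ σ) hvq
        have e : WW (mm χ σ) ((q + s, ε) :: z) =
            (fun d => mm χ σ (q, ε) d * GG (mm χ σ) ((s, 1) :: z) (d + 1)) -
              WW (mm χ σ) ((q, ε) :: (s, 1) :: z) := by
          funext d
          simp only [WW_cons, GG_cons, Pi.mul_apply, Pi.sub_apply, ps, Finset.sum_range_succ, mm,
            map_one]
          ring
        rw [e]
        have hw1 : w = q + wtl ((s, (1 : F)) :: z) := by rw [wtl_cons]; simp only; omega
        have hw2 : w = wtl ((q, ε) :: (s, (1 : F)) :: z) := by rw [wtl_cons]; exact hw1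
        refine sub_mem (Red_right ?_) ?_
        · rw [hw1]
          refine Submodule.map_mono (ES_mono ?_) h
          simp only [List.length_cons]
          omega
        · rw [← hw2] at h2
          have := ihk' (z.length + 1) (by omega) _ h2
          exact Red_mono (by omega) this
    have main : ∀ (j : ℕ) (x : ℕ × F) (z : List (ℕ × F)), q ≤ x.1 + j →
        Val N (x :: z) → wtl (x :: z) = w → w < z.length + 1 + (k + 1) →
        WW (mm χ σ) (x :: z) ∈
          Red χ N R q σ w (z.length + 2) := by
      intro j
      induction j with
      | zero => exact big
      | succ j ihj =>
        rintro ⟨p, ε⟩ z hp hv hwt hk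
        have hv' := Val_cons.1 hv
        simp only at hp hv'
        by_cases hpq : q ≤ p
        · exact big _ z hpq hv hwt hk
        · push Not at hpq
          match z with
          | [] =>
            exact Red_left (Submodule.subset_span ⟨[(p, ε)], hv, hpq, hwt, rfl⟩)
          | y :: l =>
            rw [wtl_cons] at hwt
            simp only at hwt
            have h := ihw (wtl (y :: l)) (by omega) (wtl (y :: l) + 1) y l hv'.2 rfl (by omega)
            obtain ⟨t, ht, g, hg, hg0, htg, hps⟩ := Red_elim (by omega) h
            have e : WW (mm χ σ) ((p, ε) :: y :: l) = mm χ σ (p, ε) * ps t +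
                mm χ σ (p, ε) * ps g + mm χ σ (p, ε) * g := by
              rw [WW_cons, GG_cons]
              funext d
              have h1 : ps g (d + 1) = ps g d + g d := by simp only [ps, Finset.sum_range_succ]
              simp only [Pi.mul_apply, Pi.add_apply, hps d, h1]
              ring
            rw [e]
            simp only [List.length_cons] at hk ⊢
            refine add_mem (add_mem (Red_left ?_) ?_) ?_
            · rw [← hwt]
              exact mm_GdS (x := (p, ε)) hv'.1 hpq.le ht
            · have h3 := m_mul_GS (x := (p, ε)) hv'.1 (ps_WS (ES_le_WS hg))
              rw [show (p, ε).1 + wtl (y :: l) = w from hwt] at h3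
              have := ihk' (l.length + 2) (by omega) _ h3
              exact Red_mono (by omega) this
            · have h4 := mm_merge (p := p) hv'.1.2 hg
              rw [hwt] at h4
              refine span_elim LinearMap.id ?_ h4
              rintro f ⟨ε', T, h1, h2, h3, rfl⟩
              simp only [List.length_cons] at h3
              have := ihj (p + 1, ε') T (by simp only; omega) h1 h2 (by omega)
              exact Red_mono (by omega) this
    intro x z
    exact main q x z (by omega)

end red

end Abs
namespace Abs

section conv

set_option linter.unusedSectionVars false

variable {F L : Type} [Field F] [Field L] {χ : F →+* L} {N : ℕ} {R : Subring L}
  {σ : ℕ → L} {S : ℕ → ℕ → L}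

theorem twist_WS {w n : ℕ} {ε : F} (hε : ε ^ N = 1) {f : ℕ → L}
    (hf : f ∈ WS N R (mm χ σ) w n) : (fun d => χ ε ^ d) * f ∈ WS N R (mm χ σ) w n := by
  refine span_elim (lm R (fun d => χ ε ^ d)) ?_ hf
  rintro f ⟨x, z, h1, h2, h3, rfl⟩
  have h := Val_cons.1 h1
  refine Submodule.subset_span ⟨(x.1, ε * x.2), z, Val_cons.2 ⟨⟨h.1.1, ?_⟩, h.2⟩, ?_, h3, ?_⟩
  · simp [mul_pow, hε, h.1.2]
  · rw [← h2, wtl_cons, wtl_cons]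
  · rw [lm_apply, WW_cons, WW_cons, ← mul_assoc]
    congr 1
    funext d
    simp only [mm, Pi.mul_apply, map_mul]
    ring

theorem S_mem_WS (hS1 : S 1 = σ)
    (hrec : ∀ r, 1 ≤ r → ∃ (a : ℕ → L) (b : L), (∀ j, a j ∈ R) ∧ b ∈ R ∧ ∀ d,
      S (r + 1) d = S r d * S 1 d - ∑ j ∈ Finset.Icc 1 r, a j * (S (r + 1 - j) d * ps (S j) d)
        - b * (S 1 d * ps (S r) d)) :
    ∀ s, 1 ≤ s → S s ∈ WS N R (mm χ σ) s 1 := by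
  intro s
  induction s using Nat.strong_induction_on with
  | _ s ih =>
  intro hs
  rcases hs.eq_or_lt with rfl | hs
  · have hv : Val N [((1 : ℕ), (1 : F))] := Val_cons.2 ⟨⟨by simp, by simp⟩, Val_nil⟩
    have := WW_mem (R := R) (m := mm χ σ) hv
    have e : WW (mm χ σ) [((1 : ℕ), (1 : F))] = S 1 := by
      funext d
      simp [WW, GG, mm, hS1]
    rw [e] at this
    simpa [wtl] using this
  · obtain ⟨r, rfl⟩ : ∃ r, s = r + 1 := ⟨s - 1, by omega⟩
    obtain ⟨a, b, ha, hb, h⟩ := hrec r (by omega)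
    have e : S (r + 1) = S r * S 1 - ∑ j ∈ Finset.Icc 1 r, (⟨a j, ha j⟩ : R) • (S (r + 1 - j) * ps (S j))
        - (⟨b, hb⟩ : R) • (S 1 * ps (S r)) := by
      funext d
      rw [h d]
      simp [Subring.smul_def]
    rw [e]
    refine sub_mem (sub_mem ?_ (sum_mem fun j hj => Submodule.smul_mem _ _ ?_))
      (Submodule.smul_mem _ _ ?_)
    · exact WS_mul_WS (mm_mult χ σ) (ih r (by omega) (by omega)) (ih 1 (by omega) le_rfl)
    · rw [Finset.mem_Icc] at hj
      have := WS_mul_GS (mm_mult χ σ) (ih (r + 1 - j) (by omega) (by omega))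
        (ps_WS (ih j (by omega) (by omega)))
      rwa [show r + 1 - j + j = r + 1 by omega] at this
    · have := WS_mul_GS (mm_mult χ σ) (ih 1 (by omega) (by omega))
        (ps_WS (ih r (by omega) (by omega)))
      rwa [show 1 + r = r + 1 by omega] at this

variable (χ S) in
def mS (x : ℕ × F) : ℕ → L := fun d => χ x.2 ^ d * S x.1 d

theorem WWS_mem (hS : ∀ s, 1 ≤ s → S s ∈ WS N R (mm χ σ) s 1) :
    ∀ (z : List (ℕ × F)) (x : ℕ × F), Val N (x :: z) →
      WW (mS χ S) (x :: z) ∈ WS N R (mm χ σ) (wtl (x :: z)) 1 := by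
  intro z
  induction z with
  | nil =>
    intro x hv
    have h := Val_cons.1 hv
    have := twist_WS h.1.2 (hS x.1 h.1.1)
    rw [wtl_cons, wtl_nil, WW_cons, add_zero]
    rw [show GG (mS χ S) [] = 1 from rfl, mul_one]
    exact this
  | cons y l ih =>
    intro x hv
    have h := Val_cons.1 hv
    have h1 := twist_WS h.1.2 (hS x.1 h.1.1)
    have h2 := ps_WS (ih y h.2)
    rw [wtl_cons, WW_cons, GG_cons]
    exact WS_mul_GS (mm_mult χ σ) h1 h2

theorem WWS_good {q : ℕ} (hS : ∀ s, 1 ≤ s → s ≤ q → ∀ d, S s d = σ d ^ s) :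
    ∀ z : List (ℕ × F), Val N z → Good q z → 
      WW (mS χ S) z = WW (mm χ σ) z ∧ GG (mS χ S) z = GG (mm χ σ) z
  | [], _, h => h.elim
  | x :: [], hv, h => by
    have hx := (Val_cons.1 hv).1
    have : WW (mS χ S) [x] = WW (mm χ σ) [x] := by
      funext d
      simp only [WW, GG, Pi.mul_apply, mS, mm]
      rw [hS x.1 hx.1 (le_of_lt h)]
    exact ⟨this, by rw [GG_cons, GG_cons, this]⟩
  | x :: y :: l, hv, h => by
    have hx := (Val_cons.1 hv)
    have ih := WWS_good hS (y :: l) hx.2 h.2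
    have : WW (mS χ S) (x :: y :: l) = WW (mm χ σ) (x :: y :: l) := by
      rw [WW_cons, WW_cons, ih.2]
      funext d
      simp only [Pi.mul_apply, mS, mm]
      rw [hS x.1 hx.1.1 h.1]
    exact ⟨this, by rw [GG_cons, GG_cons, this]⟩

variable [TopologicalSpace L] [IsTopologicalRing L] [T2Space L]

variable (R) in
def SZ (Z : Submodule R L) : Submodule R (ℕ → L) where
  carrier := {f | Summable f ∧ ∑' d, f d ∈ Z}
  zero_mem' := ⟨summable_zero, by simp⟩
  add_mem' := by
    rintro f g ⟨hf, hf'⟩ ⟨hg, hg'⟩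
    refine ⟨hf.add hg, ?_⟩
    have := hf.tsum_add hg
    simp only [Pi.add_apply]
    rw [this]
    exact add_mem hf' hg'
  smul_mem' := by
    rintro r f ⟨hf, hf'⟩
    have : r • f = fun d => (r : L) * f d := by funext d; simp [Subring.smul_def]
    rw [this]
    refine ⟨hf.mul_left _, ?_⟩
    rw [hf.tsum_mul_left]
    exact Z.smul_mem r hf'

theorem final {q : ℕ} (hχ : ∀ ε : F, ε ^ N = 1 → χ ε ∈ R) (hN : 0 < N) (hq : 2 ≤ q) (lam : L)
    (hlam : lam ∈ R)
    (hfund : ∀ d, σ d ^ q = lam * σ (d + 1) * ∑ j ∈ Finset.range (d + 1), σ j ^ (q - 1))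
    (hsum : ∀ x (z : List (ℕ × F)), Val N (x :: z) → Summable (WW (mm χ σ) (x :: z)))
    (w : ℕ) (Z : Submodule R L)
    (hZ : ∀ t : List (ℕ × F), Val N t → Good q t → wtl t = w → ∑' d, WW (mm χ σ) t d ∈ Z) :
    WS N R (mm χ σ) w 1 ≤ SZ R Z := by
  have key : ∀ k n, w < n + k → WS N R (mm χ σ) w n ≤ SZ R Z := by
    intro k
    induction k with
    | zero =>
      intro n hn
      refine Submodule.span_le.2 ?_
      rintro f ⟨x, z, h1, h2, h3, rfl⟩
      have := len_le_wtl h1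
      omega
    | succ k ih =>
      intro n hn
      refine Submodule.span_le.2 ?_
      rintro f ⟨x, z, h1, h2, h3, rfl⟩
      refine ⟨hsum x z h1, ?_⟩
      simp only [List.length_cons] at h3
      have h := reduce hχ hN hq lam hlam hfund w (w + 1) x z h1 h2 (by omega)
      obtain ⟨t, ht, g, hg, hg0, htg, -⟩ := Red_elim (by omega) h
      have h4 := ih (z.length + 2) (by omega) (ES_le_WS hg)
      have h5 : t ∈ SZ R Z := by
        have : GdS χ N R q σ w ≤ SZ R Z := by
          refine Submodule.span_le.2 ?_
          rintro f ⟨t, h1, h2, h3, rfl⟩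
          match t, h2 with
          | y :: l, h2 => exact ⟨hsum y l h1, hZ _ h1 h2 h3⟩
        exact this ht
      have h6 : Summable fun d => g (d + 1) := (summable_nat_add_iff 1).2 h4.1
      have h7 : ∑' d, g (d + 1) = ∑' d, g d := by
        rw [h4.1.tsum_eq_zero_add, hg0, zero_add]
      rw [htg, h5.1.tsum_add h6, h7]
      exact add_mem h5.2 h4.2
  exact key (w + 1) 1 (by omega)

end conv

end Abs
namespace Abs

section ff

set_option linter.unusedSectionVars false

variable {k L : Type} [Field k] [Fintype k] [Field L] (ι : k →+* L) (θ : L)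

def low (d : ℕ) (c : Fin d → k) : L := ∑ j, ι (c j) * θ ^ (j : ℕ)

def mon (d : ℕ) (c : Fin d → k) : L := θ ^ d + low ι θ d c

def SS (s d : ℕ) : L := ∑ c : Fin d → k, 1 / mon ι θ d c ^ s

def cc (j : ℕ) : L := ∑ f : k, (if f = 0 then 0 else (ι f)⁻¹ ^ j)

variable {ι θ}

theorem low_add (d : ℕ) (c c' : Fin d → k) : low ι θ d (c + c') = low ι θ d c + low ι θ d c' := by
  simp [low, add_mul, Finset.sum_add_distrib]

theorem low_smul (d : ℕ) (f : k) (c : Fin d → k) : low ι θ d (f • c) = ι f * low ι θ d c := by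
  simp [low, Finset.mul_sum, mul_assoc]

theorem low_zero (d : ℕ) : low ι θ d 0 = 0 := by simp [low]

theorem low_snoc (d : ℕ) (f : k) (c : Fin d → k) :
    low ι θ (d + 1) (Fin.snoc c f : Fin (d + 1) → k) = low ι θ d c + ι f * θ ^ d := by
  simp [low, Fin.sum_univ_castSucc]

theorem sum_snoc {M : Type} [AddCommMonoid M] (d : ℕ) (g : (Fin (d + 1) → k) → M) :
    ∑ c, g c = ∑ f : k, ∑ c : Fin d → k, g (Fin.snoc c f : Fin (d + 1) → k) := by
  rw [← (Fin.snocEquiv (fun _ : Fin (d + 1) => k)).sum_comp, Fintype.sum_prod_type]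
  rfl

/-- nonvanishing of nonzero polynomials -/
theorem low_ne_zero (hθ : ∀ d (c : Fin d → k), mon ι θ d c ≠ 0) :
    ∀ d (c : Fin d → k), c ≠ 0 → low ι θ d c ≠ 0 := by
  intro d
  induction d with
  | zero => intro c hc; exact absurd (Subsingleton.elim _ _) hc
  | succ d ih =>
    intro c hc
    obtain ⟨⟨f, c⟩, rfl⟩ := (Fin.snocEquiv (fun _ : Fin (d + 1) => k)).surjective c
    change low ι θ (d + 1) (Fin.snoc c f : Fin (d + 1) → k) ≠ 0
    rw [low_snoc]
    by_cases hf : f = 0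
    · subst hf
      simp only [map_zero, zero_mul, add_zero]
      apply ih
      rintro rfl
      apply hc
      funext i
      refine Fin.lastCases ?_ (fun i => ?_) i
      · simp [Fin.snocEquiv]
      · simp [Fin.snocEquiv]
    · have h := hθ d (f⁻¹ • c)
      have hf' : ι f ≠ 0 := by simpa using hf
      have e : low ι θ d c + ι f * θ ^ d = ι f * mon ι θ d (f⁻¹ • c) := by
        rw [mon, low_smul, map_inv₀]
        field_simp
        ring
      rw [e]
      exact mul_ne_zero hf' h

theorem sum_low (j : ℕ) (hj : 1 ≤ j) : ∀ d, ∑ h : Fin d → k, (low ι θ d h)⁻¹ ^ j =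
    cc ι j * ps (SS ι θ j) d := by
  intro d
  induction d with
  | zero => simp [low, ps, zero_pow (by omega : j ≠ 0)]
  | succ d ih =>
    rw [sum_snoc, ← Finset.sum_erase_add _ _ (Finset.mem_univ (0 : k))]
    have e0 : ∑ c : Fin d → k, (low ι θ (d + 1) (Fin.snoc c (0 : k) : Fin (d + 1) → k))⁻¹ ^ j =
        cc ι j * ps (SS ι θ j) d := by
      rw [← ih]
      simp [low_snoc]
    have e1 : ∀ f ∈ (Finset.univ : Finset k).erase 0,
        ∑ c : Fin d → k, (low ι θ (d + 1) (Fin.snoc c f : Fin (d + 1) → k))⁻¹ ^ j =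
        (ι f)⁻¹ ^ j * SS ι θ j d := by
      intro f hf
      have hf0 : f ≠ 0 := by simpa using hf
      have hb : Function.Bijective (fun c : Fin d → k => f • c) :=
        ⟨smul_right_injective _ hf0, fun c => ⟨f⁻¹ • c, by simp [smul_smul, hf0]⟩⟩
      rw [← hb.sum_comp, SS, Finset.mul_sum]
      refine Finset.sum_congr rfl fun c _ => ?_
      rw [low_snoc, low_smul, ← mul_add, add_comm, ← mon, mul_inv, mul_pow, one_div, inv_pow, inv_pow]
    rw [e0, Finset.sum_congr rfl e1, ← Finset.sum_mul]
    have e2 : cc ι j = ∑ f ∈ (Finset.univ : Finset k).erase 0, (ι f)⁻¹ ^ j := by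
      rw [cc, ← Finset.sum_erase_add _ _ (Finset.mem_univ (0 : k))]
      simp only [if_true, add_zero]
      refine Finset.sum_congr rfl fun f hf => ?_
      rw [if_neg (by simpa using hf)]
    rw [← e2]
    simp only [ps, Finset.sum_range_succ]
    ring

theorem partial_frac (a h : L) (ha : a ≠ 0) (hh : h ≠ 0) (hab : a + h ≠ 0) :
    ∀ r, 1 / a ^ r * (1 / (a + h)) = ∑ j ∈ Finset.Icc 1 r, (-1) ^ (j - 1) * (h⁻¹ ^ j * (1 / a ^ (r + 1 - j)))
      + (-1) ^ r * (h⁻¹ ^ r * (1 / (a + h))) := by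
  intro r
  induction r with
  | zero => simp
  | succ r ih =>
    have h1 : 1 / a ^ (r + 1) * (1 / (a + h)) = 1 / a * (1 / a ^ r * (1 / (a + h))) := by
      rw [pow_succ]; field_simp
    rw [h1, ih, Finset.sum_Icc_succ_top (by omega), mul_add, Finset.mul_sum]
    have h2 : ∀ j ∈ Finset.Icc 1 r, 1 / a * ((-1) ^ (j - 1) * (h⁻¹ ^ j * (1 / a ^ (r + 1 - j)))) =
        (-1) ^ (j - 1) * (h⁻¹ ^ j * (1 / a ^ (r + 1 + 1 - j))) := by
      intro j hj
      rw [Finset.mem_Icc] at hj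
      rw [show r + 1 + 1 - j = (r + 1 - j) + 1 by omega, pow_succ a]
      field_simp
    rw [Finset.sum_congr rfl h2]
    generalize ∑ j ∈ Finset.Icc 1 r, (-1 : L) ^ (j - 1) * (h⁻¹ ^ j * (1 / a ^ (r + 1 + 1 - j))) = A
    rw [show r + 1 + 1 - (r + 1) = 1 by omega, show r + 1 - 1 = r by omega, pow_one,
      pow_succ h⁻¹, pow_succ (-1 : L)]
    have : 1 / a * (1 / (a + h)) = h⁻¹ * (1 / a) - h⁻¹ * (1 / (a + h)) := by
      field_simp
      ring
    linear_combination ((-1) ^ r * h⁻¹ ^ r) * this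

theorem SS_rec (hθ : ∀ d (c : Fin d → k), mon ι θ d c ≠ 0) (r : ℕ) (hr : 1 ≤ r) (d : ℕ) :
    SS ι θ r d * SS ι θ 1 d = SS ι θ (r + 1) d +
      ∑ j ∈ Finset.Icc 1 r, ((-1) ^ (j - 1) * cc ι j) * (SS ι θ (r + 1 - j) d * ps (SS ι θ j) d)
        + ((-1) ^ r * cc ι r) * (SS ι θ 1 d * ps (SS ι θ r) d) := by
  have h1 : SS ι θ r d * SS ι θ 1 d = ∑ h : Fin d → k, ∑ c : Fin d → k,
      1 / mon ι θ d c ^ r * (1 / (mon ι θ d c + low ι θ d h)) := by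
    rw [Finset.sum_comm, SS, SS, Finset.sum_mul]
    refine Finset.sum_congr rfl fun c _ => ?_
    rw [Finset.mul_sum, ← Equiv.sum_comp (Equiv.addLeft c)]
    refine Finset.sum_congr rfl fun h _ => ?_
    simp only [Equiv.coe_addLeft, mon, low_add, pow_one, add_assoc]
  have h2 : ∀ h : Fin d → k, ∑ c : Fin d → k,
      1 / mon ι θ d c ^ r * (1 / (mon ι θ d c + low ι θ d h)) =
      (if h = 0 then SS ι θ (r + 1) d else 0) +
      (∑ j ∈ Finset.Icc 1 r, (-1) ^ (j - 1) * ((low ι θ d h)⁻¹ ^ j * SS ι θ (r + 1 - j) d)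
      + (-1) ^ r * ((low ι θ d h)⁻¹ ^ r * SS ι θ 1 d)) := by
    intro h
    split_ifs with h0
    · subst h0
      rw [low_zero]
      have e : ∀ j ∈ Finset.Icc 1 r, (-1 : L) ^ (j - 1) * ((0 : L)⁻¹ ^ j * SS ι θ (r + 1 - j) d) = 0 := by
        intro j hj
        rw [Finset.mem_Icc] at hj
        simp [zero_pow (by omega : j ≠ 0)]
      rw [Finset.sum_eq_zero e]
      simp only [inv_zero, zero_pow (by omega : r ≠ 0), zero_mul, mul_zero, add_zero]
      rw [SS]
      refine Finset.sum_congr rfl fun c _ => ?_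
      rw [pow_succ, one_div_mul_one_div]
    · have hl := low_ne_zero hθ d h h0
      have e : ∀ c : Fin d → k, 1 / mon ι θ d c ^ r * (1 / (mon ι θ d c + low ι θ d h)) = _ :=
        fun c => partial_frac (mon ι θ d c) (low ι θ d h) (hθ d c) hl (by
          have := hθ d (c + h)
          rwa [mon, low_add, ← add_assoc] at this) r
      rw [Finset.sum_congr rfl fun c _ => e c, zero_add, Finset.sum_add_distrib, Finset.sum_comm]
      congr 1
      · refine Finset.sum_congr rfl fun j _ => ?_
        rw [← Finset.mul_sum, ← Finset.mul_sum, SS]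
      · rw [← Finset.mul_sum, ← Finset.mul_sum, SS,
          ← Equiv.sum_comp (Equiv.addRight h) (fun c => 1 / mon ι θ d c ^ 1)]
        congr 2
        refine Finset.sum_congr rfl fun c _ => ?_
        simp only [Equiv.coe_addRight, mon, low_add, pow_one, add_assoc]
  rw [h1, Finset.sum_congr rfl fun h _ => h2 h, Finset.sum_add_distrib, Finset.sum_add_distrib,
    Finset.sum_comm]
  simp only [Finset.sum_ite_eq', Finset.mem_univ, if_true]
  rw [← add_assoc]
  congr 1
  · congr 1
    refine Finset.sum_congr rfl fun j hj => ?_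
    rw [Finset.mem_Icc] at hj
    rw [← Finset.mul_sum, ← Finset.sum_mul, sum_low j hj.1]
    ring
  · rw [← Finset.mul_sum, ← Finset.sum_mul, sum_low r hr]
    ring

theorem cc_zero (j : ℕ) (hj : 1 ≤ j) (hj' : j < Fintype.card k - 1) : cc ι j = 0 := by
  have h := FiniteField.sum_pow_lt_card_sub_one k j hj'
  have e : cc ι j = ι (∑ x : k, x ^ j) := by
    rw [map_sum, ← Equiv.sum_comp (Equiv.inv k), cc]
    refine Finset.sum_congr rfl fun f _ => ?_
    split_ifs with hf
    · subst hf; simp [zero_pow (by omega : j ≠ 0)]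
    · simp
  rw [e, h, map_zero]

theorem SS_pow (hθ : ∀ d (c : Fin d → k), mon ι θ d c ≠ 0) (d : ℕ) :
    ∀ s, 1 ≤ s → s ≤ Fintype.card k → SS ι θ s d = SS ι θ 1 d ^ s := by
  intro s hs
  induction s, hs using Nat.le_induction with
  | base => simp
  | succ r hr ih =>
    intro hle
    have h := SS_rec hθ r hr d
    rw [pow_succ, ← ih (by omega), h]
    obtain ⟨r, rfl⟩ : ∃ r', r = r' + 1 := ⟨r - 1, by omega⟩
    rw [Finset.sum_Icc_succ_top (by omega), Finset.sum_eq_zero]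
    · simp only [Nat.add_sub_cancel, Nat.add_sub_cancel_left]
      rw [pow_succ]
      ring
    · intro j hj
      rw [Finset.mem_Icc] at hj
      rw [cc_zero j hj.1 (by omega)]
      simp

end ff

end Abs
namespace Abs

section carlitz

set_option linter.unusedSectionVars false

open Polynomial

variable {k L : Type} [Field k] [Fintype k] [Field L] (ι : k →+* L) (θ : L)

include ι in
theorem add_pow_q (x y : L) : (x + y) ^ (Fintype.card k) = x ^ (Fintype.card k) + y ^ (Fintype.card k) := by
  obtain ⟨p, hp⟩ := CharP.exists k
  obtain ⟨n, hpp, hn⟩ := FiniteField.card k p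
  haveI := Fact.mk hpp
  haveI : CharP L p := charP_of_injective_ringHom ι.injective p
  rw [hn]
  exact add_pow_char_pow x y p n

include ι in
theorem sub_pow_q (x y : L) : (x - y) ^ (Fintype.card k) = x ^ (Fintype.card k) - y ^ (Fintype.card k) := by
  have := add_pow_q ι (x - y) y
  rw [sub_add_cancel] at this
  rw [this]; ring

include ι in
theorem card_cast_zero : (((Fintype.card k) : ℕ) : L) = 0 := by
  rw [← map_natCast ι, FiniteField.cast_card_eq_zero, map_zero]

variable (k) in
def DD : ℕ → L
  | 0 => 1
  | d + 1 => (θ ^ (Fintype.card k) ^ (d + 1) - θ) * DD d ^ (Fintype.card k)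

variable (k) in
def EE : ℕ → L[X]
  | 0 => X
  | d + 1 => EE d ^ (Fintype.card k) - C (DD k θ d ^ ((Fintype.card k) - 1)) * EE d

variable {ι θ}

theorem q_two : 2 ≤ (Fintype.card k) := Fintype.one_lt_card

theorem EE_deg : ∀ d, (EE k θ d).Monic ∧ (EE k θ d).natDegree = (Fintype.card k) ^ d := by
  intro d
  induction d with
  | zero => simp [EE, monic_X]
  | succ d ih =>
    have hq := q_two (k := k)
    have h1 : (EE k θ d ^ (Fintype.card k)).natDegree = (Fintype.card k) ^ (d + 1) := by
      rw [ih.1.natDegree_pow, ih.2, pow_succ, mul_comm]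
    have h2 : (C (DD k θ d ^ ((Fintype.card k) - 1)) * EE k θ d).degree < (EE k θ d ^ (Fintype.card k)).degree := by
      refine lt_of_le_of_lt ((degree_mul_le _ _).trans (add_le_add_left degree_C_le _)) ?_
      rw [zero_add, degree_eq_natDegree ih.1.ne_zero, degree_eq_natDegree (ih.1.pow _).ne_zero, h1, ih.2]
      exact_mod_cast Nat.pow_lt_pow_right (by omega) (by omega)
    refine ⟨(ih.1.pow _).sub_of_left h2, ?_⟩
    rw [EE, natDegree_eq_of_degree_eq (degree_sub_eq_left_of_degree_lt h2), h1]

include ι in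
theorem EE_add (x y : L) : ∀ d, (EE k θ d).eval (x + y) = (EE k θ d).eval x + (EE k θ d).eval y := by
  intro d
  induction d with
  | zero => simp [EE]
  | succ d ih =>
    simp only [EE, eval_sub, eval_pow, eval_mul, eval_C, ih]
    rw [add_pow_q ι]; ring

theorem EE_smul (f : k) (x : L) : ∀ d, (EE k θ d).eval (ι f * x) = ι f * (EE k θ d).eval x := by
  intro d
  induction d with
  | zero => simp [EE]
  | succ d ih =>
    simp only [EE, eval_sub, eval_pow, eval_mul, eval_C, ih]
    rw [mul_pow, ← map_pow, FiniteField.pow_card]; ring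

include ι in
theorem EE_theta (x : L) : ∀ d, (EE k θ (d + 1)).eval (θ * x) =
    θ * (EE k θ (d + 1)).eval x + (θ ^ (Fintype.card k) ^ (d + 1) - θ) * (EE k θ d).eval x ^ (Fintype.card k) := by
  intro d
  induction d with
  | zero =>
    simp [EE, DD, mul_pow]; ring
  | succ d ih =>
    have hq := q_two (k := k)
    have h1 : (EE k θ (d + 1 + 1)).eval (θ * x) = ((EE k θ (d + 1)).eval (θ * x)) ^ (Fintype.card k) -
        DD k θ (d + 1) ^ ((Fintype.card k) - 1) * (EE k θ (d + 1)).eval (θ * x) := by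
      rw [EE]; simp
    have h2 : (EE k θ (d + 1 + 1)).eval x = ((EE k θ (d + 1)).eval x) ^ (Fintype.card k) -
        DD k θ (d + 1) ^ ((Fintype.card k) - 1) * (EE k θ (d + 1)).eval x := by
      rw [EE]; simp
    have h3 : (EE k θ (d + 1)).eval x = ((EE k θ d).eval x) ^ (Fintype.card k) -
        DD k θ d ^ ((Fintype.card k) - 1) * (EE k θ d).eval x := by
      rw [EE]; simp
    rw [h1, h2, ih, add_pow_q ι]
    have h5 : (θ ^ (Fintype.card k) ^ (d + 1) - θ) ^ (Fintype.card k) = θ ^ (Fintype.card k) ^ (d + 1 + 1) - θ ^ (Fintype.card k) := by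
      rw [sub_pow_q ι, ← pow_mul, ← pow_succ]
    have h4 : θ ^ (Fintype.card k) ^ (d + 1 + 1) - θ = (θ ^ (Fintype.card k) ^ (d + 1) - θ) ^ (Fintype.card k) + (θ ^ (Fintype.card k) - θ) := by
      rw [h5]; ring
    have h6 : DD k θ (d + 1) ^ ((Fintype.card k) - 1) * (θ ^ (Fintype.card k) ^ (d + 1) - θ) =
        (θ ^ (Fintype.card k) ^ (d + 1) - θ) ^ (Fintype.card k) * (DD k θ d ^ ((Fintype.card k) - 1)) ^ (Fintype.card k) := by
      rw [DD, mul_pow]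
      obtain ⟨r, hr⟩ : ∃ r, (Fintype.card k) = r + 1 := ⟨(Fintype.card k) - 1, by omega⟩
      rw [hr]
      simp only [Nat.add_sub_cancel]
      ring
    rw [h4]
    have h7 : (EE k θ (d + 1)).eval x ^ (Fintype.card k) = ((EE k θ d).eval x ^ (Fintype.card k)) ^ (Fintype.card k) -
        (DD k θ d ^ ((Fintype.card k) - 1)) ^ (Fintype.card k) * (EE k θ d).eval x ^ (Fintype.card k) := by
      rw [h3, sub_pow_q ι, mul_pow]
    generalize (θ ^ (Fintype.card k) ^ (d + 1) - θ) = b at *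
    generalize DD k θ (d + 1) ^ ((Fintype.card k) - 1) = D1 at *
    generalize (DD k θ d ^ ((Fintype.card k) - 1)) ^ (Fintype.card k) = D0 at *
    rw [mul_pow, mul_pow]
    linear_combination (-(EE k θ d).eval x ^ (Fintype.card k)) * h6 - b ^ (Fintype.card k) * h7

include ι in
theorem EE_vals : ∀ d, (EE k θ d).eval (θ ^ d) = DD k θ d ∧ ∀ j < d, (EE k θ d).eval (θ ^ j) = 0 := by
  intro d
  induction d with
  | zero => simp [EE, DD]
  | succ d ih =>
    have hq := q_two (k := k)
    have h0 : (EE k θ (d + 1)).eval (θ ^ d) = 0 := by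
      rw [EE]
      simp only [eval_sub, eval_pow, eval_mul, eval_C, ih.1]
      rw [← pow_succ, Nat.sub_add_cancel (by omega), sub_self]
    refine ⟨?_, ?_⟩
    · rw [pow_succ', EE_theta (ι := ι), h0, ih.1, DD]; ring
    · intro j hj
      rcases (Nat.lt_succ_iff.1 hj).eq_or_lt with rfl | h
      · exact h0
      · rw [EE]
        simp only [eval_sub, eval_pow, eval_mul, eval_C, ih.2 j h]
        rw [zero_pow (by omega)]; ring

theorem EE_low (d : ℕ) (c : Fin d → k) : (EE k θ d).eval (low ι θ d c) = 0 := by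
  have h0 : (EE k θ d).eval 0 = 0 := by
    have := EE_add (ι := ι) (θ := θ) 0 0 d
    simpa using this
  let φ : L →+ L := { toFun := fun x => (EE k θ d).eval x, map_zero' := h0, map_add' := fun x y => EE_add (ι := ι) x y d }
  change φ (low ι θ d c) = 0
  rw [low, map_sum]
  refine Finset.sum_eq_zero fun j _ => ?_
  change (EE k θ d).eval _ = 0
  rw [EE_smul, (EE_vals (ι := ι) d).2 j j.2, mul_zero]

theorem EE_mon (d : ℕ) (c : Fin d → k) : (EE k θ d).eval (mon ι θ d c) = DD k θ d := by
  rw [mon, EE_add (ι := ι), EE_low, (EE_vals (ι := ι) d).1, add_zero]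

theorem mon_inj (hθ : ∀ d (c : Fin d → k), mon ι θ d c ≠ 0) (d : ℕ) :
    Function.Injective (mon ι θ d) := by
  intro c c' h
  by_contra hne
  have h1 := low_ne_zero hθ d (c - c') (sub_ne_zero.2 hne)
  apply h1
  have : low ι θ d c = low ι θ d (c - c') + low ι θ d c' := by rw [← low_add, sub_add_cancel]
  simp only [mon, add_right_inj] at h
  rw [h] at this
  simpa using this.symm

theorem EE_prod (hθ : ∀ d (c : Fin d → k), mon ι θ d c ≠ 0) (d : ℕ) :
    EE k θ d - C (DD k θ d) = ∏ c : Fin d → k, (X - C (mon ι θ d c)) := by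
  have hq := q_two (k := k)
  have hE := EE_deg (k := k) (θ := θ) d
  have hpos : 0 < (Fintype.card k) ^ d := Nat.pow_pos (by omega)
  have hlt : (C (DD k θ d)).degree < (EE k θ d).degree := by
    refine lt_of_le_of_lt degree_C_le ?_
    rw [degree_eq_natDegree hE.1.ne_zero, hE.2]
    exact_mod_cast hpos
  have hm : (EE k θ d - C (DD k θ d)).Monic := hE.1.sub_of_left hlt
  have hd1 : (EE k θ d - C (DD k θ d)).degree = (((Fintype.card k) ^ d : ℕ) : WithBot ℕ) := by
    rw [degree_sub_eq_left_of_degree_lt hlt, degree_eq_natDegree hE.1.ne_zero, hE.2]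
  have hm2 : (∏ c : Fin d → k, (X - C (mon ι θ d c))).Monic :=
    monic_prod_of_monic _ _ fun c _ => monic_X_sub_C _
  have hd2 : (∏ c : Fin d → k, (X - C (mon ι θ d c))).degree = (((Fintype.card k) ^ d : ℕ) : WithBot ℕ) := by
    rw [degree_prod]
    simp
  refine eq_of_degree_sub_lt_of_eval_index_eq (Finset.univ : Finset (Fin d → k)) (v := mon ι θ d)
    (mon_inj hθ d).injOn ?_ ?_
  · have := degree_sub_lt (hd1.trans hd2.symm) hm.ne_zero (by rw [hm.leadingCoeff, hm2.leadingCoeff])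
    rw [hd1] at this
    simpa using this
  · intro c _
    rw [eval_sub, EE_mon, eval_C, sub_self, eval_prod, eq_comm]
    exact Finset.prod_eq_zero (Finset.mem_univ c) (by simp)

variable (k θ) in
def ee : ℕ → L
  | 0 => 1
  | d + 1 => - DD k θ d ^ ((Fintype.card k) - 1) * ee d

include ι in
theorem EE_deriv : ∀ d, derivative (EE k θ d) = C (ee k θ d) := by
  intro d
  induction d with
  | zero => simp [EE, ee]
  | succ d ih =>
    rw [EE, derivative_sub, derivative_pow, card_cast_zero ι, derivative_C_mul, ih, ee]
    simp

theorem SS_one (hθ : ∀ d (c : Fin d → k), mon ι θ d c ≠ 0) (d : ℕ) :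
    ee k θ d = DD k θ d * SS ι θ 1 d := by
  have h := EE_prod hθ d
  have h0 := congrArg (fun P => P.eval 0) h
  have h1 := congrArg (fun P => (derivative P).eval 0) h
  simp only [derivative_sub, derivative_C, sub_zero, EE_deriv (ι := ι), eval_C, eval_sub,
    derivative_prod_finset, eval_finsetSum, eval_mul, eval_prod, derivative_X, eval_X,
    eval_one, mul_one, zero_sub] at h0 h1
  have hE0 : (EE k θ d).eval 0 = 0 := by
    have := EE_add (ι := ι) (θ := θ) 0 0 d
    simpa using this
  rw [hE0, zero_sub] at h0
  rw [h1, SS, Finset.mul_sum]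
  refine Finset.sum_congr rfl fun c _ => ?_
  rw [← Finset.mul_prod_erase _ _ (Finset.mem_univ c)] at h0
  have hc := hθ d c
  have : DD k θ d = mon ι θ d c * ∏ x ∈ Finset.univ.erase c, -mon ι θ d x := by
    linear_combination -h0
  rw [this, pow_one]
  field_simp

theorem SS_step (hθ : ∀ d (c : Fin d → k), mon ι θ d c ≠ 0)
    (hb : ∀ i, 1 ≤ i → θ ^ (Fintype.card k) ^ i ≠ θ) (d : ℕ) :
    SS ι θ 1 d = (θ - θ ^ (Fintype.card k) ^ (d + 1)) * SS ι θ 1 (d + 1) := by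
  have hq := q_two (k := k)
  have hD : ∀ d, DD k θ d ≠ 0 := by
    intro d
    induction d with
    | zero => simp [DD]
    | succ d ih =>
      rw [DD]
      exact mul_ne_zero (sub_ne_zero.2 (hb _ (by omega))) (pow_ne_zero _ ih)
  have h1 := SS_one hθ d
  have h2 := SS_one hθ (d + 1)
  rw [ee, DD, h1] at h2
  have e : DD k θ d ^ (Fintype.card k) = DD k θ d ^ ((Fintype.card k) - 1) * DD k θ d := by
    rw [← pow_succ, Nat.sub_add_cancel (by omega)]
  have h3 : DD k θ d ^ (Fintype.card k) ≠ 0 := pow_ne_zero _ (hD d)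
  apply mul_left_cancel₀ h3
  rw [e] at h2 ⊢
  linear_combination -h2

theorem SS_zero (s : ℕ) : SS ι θ s 0 = 1 := by
  simp [SS, mon, low]

theorem SS_fund (hθ : ∀ d (c : Fin d → k), mon ι θ d c ≠ 0)
    (hb : ∀ i, 1 ≤ i → θ ^ (Fintype.card k) ^ i ≠ θ) (d : ℕ) :
    SS ι θ 1 d ^ (Fintype.card k) = (θ - θ ^ (Fintype.card k)) * SS ι θ 1 (d + 1) *
      ∑ j ∈ Finset.range (d + 1), SS ι θ 1 j ^ ((Fintype.card k) - 1) := by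
  have hq := q_two (k := k)
  induction d with
  | zero =>
    have := SS_step hθ hb 0
    rw [SS_zero] at this ⊢
    simp only [zero_add, pow_one] at this
    simp [SS_zero, ← this]
  | succ d ih =>
    have h1 := SS_step hθ hb d
    have h2 := SS_step hθ hb (d + 1)
    have hne : SS ι θ 1 (d + 1) ≠ 0 := by
      have : ∀ d, SS ι θ 1 d ≠ 0 := by
        intro d
        induction d with
        | zero => rw [SS_zero]; exact one_ne_zero
        | succ d ih => 
          intro h0
          apply ih
          rw [SS_step hθ hb d, h0, mul_zero]
      exact this _
    have e : SS ι θ 1 (d + 1) ^ (Fintype.card k) = SS ι θ 1 (d + 1) ^ ((Fintype.card k) - 1) * SS ι θ 1 (d + 1) := by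
      rw [← pow_succ, Nat.sub_add_cancel (by omega)]
    have hbq : θ - θ ^ (Fintype.card k) ^ (d + 1 + 1) = (θ - θ ^ (Fintype.card k) ^ (d + 1)) ^ (Fintype.card k) + (θ - θ ^ (Fintype.card k)) := by
      rw [sub_pow_q ι, ← pow_mul, ← pow_succ]; ring
    rw [Finset.sum_range_succ]
    rw [h1, mul_pow, e] at ih
    have ih' : (θ - θ ^ (Fintype.card k) ^ (d + 1)) ^ (Fintype.card k) * SS ι θ 1 (d + 1) ^ ((Fintype.card k) - 1) =
        (θ - θ ^ (Fintype.card k)) * ∑ j ∈ Finset.range (d + 1), SS ι θ 1 j ^ ((Fintype.card k) - 1) := by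
      apply mul_right_cancel₀ hne
      linear_combination ih
    rw [e]
    rw [hbq] at h2
    linear_combination SS ι θ 1 (d + 1) ^ ((Fintype.card k) - 1) * h2 + SS ι θ 1 (d + 1 + 1) * ih'

end carlitz

end Abs
namespace Abs

theorem nonarch (K : Type) [Field K] : NonarchimedeanAddGroup (LaurentSeries K) where
  is_nonarchimedean := by
    intro U hU
    rw [Valued.mem_nhds_zero] at hU
    obtain ⟨γ, hγ⟩ := hU
    have hopen : ((Valued.v.restrict.ltAddSubgroup γ : AddSubgroup (LaurentSeries K)) :
        Set (LaurentSeries K)) ∈ nhds (0 : LaurentSeries K) := by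
      rw [Valued.mem_nhds_zero]
      exact ⟨γ, fun x hx => hx⟩
    exact ⟨⟨_, AddSubgroup.isOpen_of_mem_nhds _ hopen⟩, hγ⟩

theorem summ (K : Type) [Field K] (f : ℕ → LaurentSeries K)
    (h : ∀ d : ℕ, ∀ n < (d : ℤ), (f d).coeff n = 0) : Summable f := by
  have := nonarch K
  apply NonarchimedeanAddGroup.summable_of_tendsto_cofinite_zero
  rw [Nat.cofinite_eq_atTop]
  intro U hU
  rw [Valued.mem_nhds_zero] at hU
  obtain ⟨γ, hγ⟩ := hU
  obtain ⟨x, hx⟩ := MonoidWithZeroHom.ValueGroup₀.restrict₀_surjective _ γ.1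
  have hx' : Valued.v.restrict x = γ.1 := hx
  have hx0 : x ≠ 0 := by
    rintro rfl
    rw [map_zero] at hx'
    exact γ.ne_zero hx'.symm
  rw [Filter.mem_map, Filter.mem_atTop_sets]
  refine ⟨(x.order + 1).toNat, fun d hd => hγ ?_⟩
  rw [Set.mem_ofPred_eq, ← hx', Valuation.restrict_lt_iff]
  by_contra hcon
  push Not at hcon
  have h1 : Valued.v x ≤ WithZero.exp (-(d : ℤ)) :=
    hcon.trans ((LaurentSeries.valuation_le_iff_coeff_lt_eq_zero K).2 (h d))
  rw [LaurentSeries.valuation_le_iff_coeff_lt_eq_zero K] at h1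
  exact (HahnSeries.coeff_order_eq_zero.not.2 hx0) (h1 _ (by omega))

end Abs
namespace Abs

set_option linter.unusedSectionVars false

def io : Fq →+* Kinf Fq := (cst Fq).comp (algebraMap Fq (Fb Fq))

theorem v_cst (a : Fb Fq) : Valued.v (cst Fq a) ≤ 1 := by
  have := (LaurentSeries.valuation_le_iff_coeff_lt_eq_zero (Fb Fq) (D := 0) (f := cst Fq a)).2
  simp only [neg_zero, WithZero.exp_zero] at this
  apply this
  intro n hn
  rw [cst, HahnSeries.C_apply, HahnSeries.coeff_single_of_ne hn.ne]

theorem v_theta : Valued.v (theta Fq) = WithZero.exp (1 : ℤ) := by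
  have := LaurentSeries.valuation_single_zpow (Fb Fq) (-1)
  rw [theta, this]; simp

theorem v_theta_pow (n : ℕ) : Valued.v (theta Fq ^ n) = WithZero.exp (n : ℤ) := by
  rw [map_pow, v_theta, ← WithZero.exp_nsmul]; simp

theorem mon_ne (d : ℕ) (c : Fin d → Fq) : mon (io Fq) (theta Fq) d c ≠ 0 := by
  have h1 : Valued.v (low (io Fq) (theta Fq) d c) < Valued.v (theta Fq ^ d) := by
    rw [low]
    refine Valuation.map_sum_lt _ ?_ ?_
    · rw [v_theta_pow]; exact WithZero.exp_ne_zero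
    · intro j _
      rw [map_mul, v_theta_pow, v_theta_pow]
      refine lt_of_le_of_lt (mul_le_mul_left (v_cst Fq _) _) ?_
      rw [one_mul, WithZero.exp_lt_exp]
      exact_mod_cast j.2
  intro h0
  have h2 : Valued.v (mon (io Fq) (theta Fq) d c) = Valued.v (theta Fq ^ d) := by
    rw [mon, Valuation.map_add_eq_of_lt_left _ h1]
  rw [h0, map_zero, v_theta_pow] at h2
  exact WithZero.exp_ne_zero h2.symm

theorem q_pow_lt (i : ℕ) (hi : 1 ≤ i) : 1 < Fintype.card Fq ^ i :=
  Nat.one_lt_pow (by omega) Fintype.one_lt_card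

theorem theta_ne (i : ℕ) (hi : 1 ≤ i) : theta Fq ^ Fintype.card Fq ^ i ≠ theta Fq := by
  intro h
  have h2 := congrArg Valued.v h
  rw [v_theta_pow, v_theta, WithZero.exp_inj] at h2
  have := q_pow_lt Fq i hi
  omega

def sg : ℕ → Kinf Fq := SS (io Fq) (theta Fq) 1

theorem v_sg (d : ℕ) : Valued.v (sg Fq d) ≤ WithZero.exp (-(d : ℤ)) := by
  induction d with
  | zero => simp [sg, SS_zero]
  | succ d ih =>
    have h := SS_step (mon_ne Fq) (theta_ne Fq) d
    have hQ := q_pow_lt Fq (d + 1) (by omega)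
    have hb : Valued.v (theta Fq - theta Fq ^ Fintype.card Fq ^ (d + 1)) =
        WithZero.exp ((Fintype.card Fq ^ (d + 1) : ℕ) : ℤ) := by
      rw [Valuation.map_sub_eq_of_lt_right, v_theta_pow]
      rw [v_theta_pow, v_theta, WithZero.exp_lt_exp]
      exact_mod_cast hQ
    change sg Fq d = _ * sg Fq (d + 1) at h
    rw [h, map_mul, hb] at ih
    have h3 : WithZero.exp (1 : ℤ) * Valued.v (sg Fq (d + 1)) ≤ WithZero.exp (-(d : ℤ)) := by
      refine le_trans (mul_le_mul_left (WithZero.exp_le_exp.2 ?_) _) ih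
      exact_mod_cast hQ.le
    have h4 : WithZero.exp (-1 : ℤ) * (WithZero.exp (1 : ℤ) * Valued.v (sg Fq (d + 1))) ≤
        WithZero.exp (-1 : ℤ) * WithZero.exp (-(d : ℤ)) := mul_le_mul_right h3 _
    rw [← mul_assoc, ← WithZero.exp_add, ← WithZero.exp_add] at h4
    simp only [neg_add_cancel, WithZero.exp_zero, one_mul] at h4
    refine h4.trans (le_of_eq ?_)
    congr 1; push_cast; ring

theorem v_ww : ∀ (z : List (ℕ × Fb Fq)), (∀ x ∈ z, 0 < x.1) → 
    (∀ d, Valued.v (WW (mm (cst Fq) (sg Fq)) z d) ≤ WithZero.exp (-(d : ℤ))) ∧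
    (∀ d, Valued.v (GG (mm (cst Fq) (sg Fq)) z d) ≤ 1) := by
  intro z
  induction z with
  | nil => 
    intro _
    refine ⟨fun d => ?_, fun d => ?_⟩
    · change Valued.v (0 : Kinf Fq) ≤ _
      simp
    · change Valued.v (1 : Kinf Fq) ≤ _
      simp
  | cons x z ih =>
    intro hz
    obtain ⟨-, h2⟩ := ih fun y hy => hz y (List.mem_cons_of_mem _ hy)
    have hx : 0 < x.1 := hz x List.mem_cons_self
    have hW : ∀ d, Valued.v (WW (mm (cst Fq) (sg Fq)) (x :: z) d) ≤ WithZero.exp (-(d : ℤ)) := by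
      intro d
      rw [WW_cons]
      change Valued.v ((cst Fq x.2 ^ d * sg Fq d ^ x.1) * GG (mm (cst Fq) (sg Fq)) z d) ≤ _
      have h1 : Valued.v (sg Fq d) ≤ 1 := (v_sg Fq d).trans (by
        rw [← WithZero.exp_zero, WithZero.exp_le_exp]; omega)
      obtain ⟨s, hs⟩ : ∃ s, x.1 = s + 1 := ⟨x.1 - 1, by omega⟩
      rw [hs, map_mul, map_mul, map_pow, map_pow, pow_succ]
      calc _ ≤ (1 * (1 * WithZero.exp (-(d : ℤ)))) * 1 :=
            mul_le_mul' (mul_le_mul' (pow_le_one' (v_cst Fq _) _)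
              (mul_le_mul' (pow_le_one' h1 _) (v_sg Fq d))) (h2 d)
        _ = _ := by simp
    refine ⟨hW, fun d => ?_⟩
    rw [GG_cons]
    refine Valuation.map_sum_le _ fun j _ => (hW j).trans ?_
    rw [← WithZero.exp_zero, WithZero.exp_le_exp]; omega

theorem hsum (N : ℕ) (x : ℕ × Fb Fq) (z : List (ℕ × Fb Fq)) (h : Val N (x :: z)) :
    Summable (WW (mm (cst Fq) (sg Fq)) (x :: z)) := by
  refine summ _ _ fun d => ?_
  rw [← LaurentSeries.valuation_le_iff_coeff_lt_eq_zero]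
  exact (v_ww Fq (x :: z) fun y hy => (h y hy).1).1 d

theorem cst_mem (N : ℕ) (a : Fb Fq) (ha : a ∈ kN Fq N) : cst Fq a ∈ AN Fq N :=
  Subring.subset_closure (Or.inl ⟨a, ha, rfl⟩)

theorem root_mem (N : ℕ) (a : Fb Fq) (ha : a ^ N = 1) : cst Fq a ∈ AN Fq N :=
  cst_mem Fq N a (Subfield.subset_closure (Or.inr ha))

theorem theta_mem (N : ℕ) : theta Fq ∈ AN Fq N :=
  Subring.subset_closure (Or.inr rfl)

theorem cc_mem (N j : ℕ) : cc (io Fq) j ∈ AN Fq N := by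
  refine Subring.sum_mem _ fun f _ => ?_
  split_ifs
  · exact Subring.zero_mem _
  · refine Subring.pow_mem _ ?_ _
    rw [← map_inv₀]
    exact cst_mem Fq N _ (Subfield.subset_closure (Or.inl ⟨_, rfl⟩))

theorem SS_mem (N : ℕ) : ∀ s, 1 ≤ s →
    SS (io Fq) (theta Fq) s ∈ WS N (AN Fq N) (mm (cst Fq) (sg Fq)) s 1 := by
  refine S_mem_WS (S := SS (io Fq) (theta Fq)) rfl fun r hr =>
    ⟨fun j => (-1) ^ (j - 1) * cc (io Fq) j, (-1) ^ r * cc (io Fq) r, fun j => ?_, ?_, fun d => ?_⟩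
  · exact Subring.mul_mem _ (Subring.pow_mem _ (Subring.neg_mem _ (Subring.one_mem _)) _) (cc_mem Fq N j)
  · exact Subring.mul_mem _ (Subring.pow_mem _ (Subring.neg_mem _ (Subring.one_mem _)) _) (cc_mem Fq N r)
  · have := SS_rec (mon_ne Fq) r hr d
    linear_combination -this

/-- The abstract form of the main theorem. -/
theorem main_abs (N w : ℕ) (hN : 0 < N) (Z : Submodule (AN Fq N) (Kinf Fq))
    (hZ : ∀ t : List (ℕ × Fb Fq), Val N t → Good (qc Fq) t → wtl t = w →
      ∑' d, WW (mS (cst Fq) (SS (io Fq) (theta Fq))) t d ∈ Z)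
    (x : ℕ × Fb Fq) (z : List (ℕ × Fb Fq)) (hv : Val N (x :: z)) (hw : wtl (x :: z) = w) :
    ∑' d, WW (mS (cst Fq) (SS (io Fq) (theta Fq))) (x :: z) d ∈ Z := by
  have h1 := WWS_mem (SS_mem Fq N) z x hv
  rw [hw] at h1
  have h2 := final (χ := cst Fq) (N := N) (R := AN Fq N) (σ := sg Fq) (q := qc Fq)
    (root_mem Fq N) hN (q_two (k := Fq)) (theta Fq - theta Fq ^ Fintype.card Fq)
    (Subring.sub_mem _ (theta_mem Fq N) (Subring.pow_mem _ (theta_mem Fq N) _))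
    (SS_fund (mon_ne Fq) (theta_ne Fq)) (hsum Fq N) w Z (fun t h1 h2 h3 => by
      rw [← (WWS_good (χ := cst Fq) (σ := sg Fq) (S := SS (io Fq) (theta Fq)) (fun s hs hs' d => SS_pow (mon_ne Fq) d s hs hs') t h1 h2).1]
      exact hZ t h1 h2 h3) h1
  exact h2.2

end Abs
namespace Abs

section bridge

variable {L : Type} [Field L] {α : Type}

def PP (n d : ℕ) : Finset (Fin n → ℕ) :=
  (Fintype.piFinset fun _ => Finset.range d).filter StrictAnti

theorem mem_PP {n d : ℕ} {f : Fin n → ℕ} : f ∈ PP n d ↔ (∀ i, f i < d) ∧ StrictAnti f := by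
  simp [PP, Fintype.mem_piFinset]

theorem anti_cons {n j : ℕ} {g : Fin n → ℕ} (hg : g ∈ PP n j) :
    StrictAnti (Fin.cons j g : Fin (n + 1) → ℕ) := by
  rw [mem_PP] at hg
  intro a b hab
  induction a using Fin.cases with
  | zero =>
    induction b using Fin.cases with
    | zero => exact absurd hab (lt_irrefl _)
    | succ b => simpa using hg.1 b
  | succ a =>
    induction b using Fin.cases with
    | zero => exact absurd hab (by simp)
    | succ b => simpa using hg.2 (by simpa using hab)

theorem tail_PP {n : ℕ} {f : Fin (n + 1) → ℕ} (hf : StrictAnti f) : Fin.tail f ∈ PP n (f 0) := by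
  rw [mem_PP]
  exact ⟨fun i => hf (Fin.succ_pos i), fun a b hab => hf (by simpa using hab)⟩

theorem GG_ofFn (m : α → ℕ → L) : ∀ (n : ℕ) (a : Fin n → α) (d : ℕ),
    GG m (List.ofFn a) d = ∑ f ∈ PP n d, ∏ i, m (a i) (f i) := by
  intro n
  induction n with
  | zero =>
    intro a d
    have : PP 0 d = Finset.univ := by
      ext f
      simp only [mem_PP, Finset.mem_univ, iff_true]
      exact ⟨fun i => i.elim0, fun i => i.elim0⟩
    rw [this]
    simp only [List.ofFn_zero, Finset.univ_eq_empty, Finset.prod_empty]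
    change (1 : L) = _
    simp
  | succ n ih =>
    intro a d
    rw [List.ofFn_succ, GG_cons]
    change ∑ j ∈ Finset.range d, WW m _ j = _
    have : ∀ j, WW m (a 0 :: List.ofFn fun i => a i.succ) j =
        ∑ g ∈ PP n j, ∏ i, m (a i) ((Fin.cons j g : Fin (n + 1) → ℕ) i) := by
      intro j
      rw [WW_cons, Pi.mul_apply, ih, Finset.mul_sum]
      refine Finset.sum_congr rfl fun g _ => ?_
      rw [Fin.prod_univ_succ]
      simp
    simp only [this]
    rw [Finset.sum_sigma']
    refine Finset.sum_bij' (fun x _ => (Fin.cons x.1 x.2 : Fin (n + 1) → ℕ))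
      (fun f _ => ⟨f 0, Fin.tail f⟩) ?_ ?_ ?_ ?_ ?_
    · rintro ⟨j, g⟩ h
      simp only [Finset.mem_sigma, Finset.mem_range] at h
      have ha := anti_cons h.2
      rw [mem_PP]
      refine ⟨fun i => ?_, ha⟩
      refine lt_of_le_of_lt (ha.antitone (Fin.zero_le i)) ?_
      simpa using h.1
    · intro f hf
      rw [mem_PP] at hf
      simp only [Finset.mem_sigma, Finset.mem_range]
      exact ⟨hf.1 0, tail_PP hf.2⟩
    · rintro ⟨j, g⟩ h
      simp
    · intro f hf
      simp
    · rintro ⟨j, g⟩ h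
      rfl

variable [TopologicalSpace L]

theorem WW_ofFn (m : α → ℕ → L) (n : ℕ) (a : Fin (n + 1) → α) (d : ℕ) :
    ∑' f : {f : Fin (n + 1) → ℕ // StrictAnti f ∧ ∀ i : Fin (n + 1), i.val = 0 → (f i : ℤ) = (d : ℤ)},
      ∏ i, m (a i) (f.1 i) = WW m (List.ofFn a) d := by
  have h1 : WW m (List.ofFn a) d =
        ∑ g ∈ PP n d, ∏ i, m (a i) ((Fin.cons d g : Fin (n + 1) → ℕ) i) := by
    rw [List.ofFn_succ, WW_cons, Pi.mul_apply, GG_ofFn, Finset.mul_sum]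
    refine Finset.sum_congr rfl fun g _ => ?_
    rw [Fin.prod_univ_succ]
    simp
  let e : {g : Fin n → ℕ // g ∈ PP n d} ≃ {f : Fin (n + 1) → ℕ // StrictAnti f ∧
      ∀ i : Fin (n + 1), i.val = 0 → (f i : ℤ) = (d : ℤ)} :=
    { toFun := fun g => ⟨Fin.cons d g.1, anti_cons g.2, fun i hi => by
        have : i = 0 := Fin.ext hi
        subst this; simp⟩
      invFun := fun f => ⟨Fin.tail f.1, by
        have h0 : f.1 0 = d := by exact_mod_cast f.2.2 0 rfl
        exact (congrArg (fun j => Fin.tail f.1 ∈ PP n j) h0).mp (tail_PP f.2.1)⟩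
      left_inv := fun g => by simp
      right_inv := fun f => by
        have h0 : f.1 0 = d := by exact_mod_cast f.2.2 0 rfl
        apply Subtype.ext
        exact (congrArg (fun j => (Fin.cons j (Fin.tail f.1) : Fin (n + 1) → ℕ)) h0.symm).trans
          (Fin.cons_self_tail f.1) }
  rw [h1, ← e.tsum_eq, ← Finset.tsum_subtype]
  rfl

end bridge

theorem Sd_eq (n : ℕ) (s : Fin (n + 1) → ℕ) (eps : Fin (n + 1) → Fb Fq) (d : ℕ) :
    Sd Fq (d : ℤ) ⟨n + 1, s, eps⟩ =
      WW (mS (cst Fq) (SS (io Fq) (theta Fq))) (List.ofFn fun i => (s i, eps i)) d := by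
  rw [← WW_ofFn, Sd]
  refine tsum_congr fun f => ?_
  have h : ∀ i, mS (cst Fq) (SS (io Fq) (theta Fq)) (s i, eps i) (f.1 i) =
      ∑ c : Fin (f.1 i) → Fq, cst Fq (eps i ^ f.1 i) / monicVal Fq (f.1 i) c ^ s i := by
    intro i
    rw [mS, SS, Finset.mul_sum]
    refine Finset.sum_congr rfl fun c _ => ?_
    rw [map_pow, mul_one_div]
    rfl
  simp only [h]
  rw [Finset.prod_univ_sum, Fintype.piFinset_univ]

theorem zeta_eq (n : ℕ) (s : Fin (n + 1) → ℕ) (eps : Fin (n + 1) → Fb Fq) :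
    zetaA Fq ⟨n + 1, s, eps⟩ =
      ∑' d, WW (mS (cst Fq) (SS (io Fq) (theta Fq))) (List.ofFn fun i => (s i, eps i)) d :=
  tsum_congr fun d => Sd_eq Fq n s eps d

theorem good_iff {q : ℕ} {F : Type} : ∀ (n : ℕ) (a : Fin (n + 1) → ℕ × F), Good q (List.ofFn a) →
    (∀ i : Fin (n + 1), i.val < n → (a i).1 ≤ q) ∧ ∀ i : Fin (n + 1), i.val = n → (a i).1 < q := by
  intro n
  induction n with
  | zero =>
    intro a h
    simp only [List.ofFn_succ, List.ofFn_zero, Good] at h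
    refine ⟨fun i hi => absurd hi (by omega), fun i hi => ?_⟩
    have : i = 0 := Fin.ext hi
    subst this; exact h
  | succ n ih =>
    intro a h
    rw [List.ofFn_succ] at h
    have h' : (a 0).1 ≤ q ∧ Good q (List.ofFn fun i : Fin (n + 1) => a i.succ) := by
      rw [List.ofFn_succ] at h ⊢
      exact h
    obtain ⟨h1, h2⟩ := ih _ h'.2
    refine ⟨fun i => ?_, fun i => ?_⟩
    · refine Fin.cases (fun _ => h'.1) (fun i hi => h1 i ?_) i
      simp only [Fin.val_succ] at hi; omega
    · refine Fin.cases (fun hi => ?_) (fun i hi => h2 i ?_) i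
      · simp at hi
      · simp only [Fin.val_succ] at hi; omega

theorem main_Z (N w : ℕ) (hN : 0 < N) (hw : 0 < w) (A : PArr (Fb Fq)) (hA : A.Positive N)
    (hAw : A.wt = w) :
    zetaA Fq A ∈ Submodule.span (AN Fq N)
      {x | ∃ U : PArr (Fb Fq), U.Positive N ∧ InTw (qc Fq) w U ∧ x = zetaA Fq U} := by
  obtain ⟨n, s, eps⟩ := A
  cases n with
  | zero =>
    exfalso
    simp [PArr.wt] at hAw
    omega
  | succ n =>
    rw [zeta_eq, List.ofFn_succ]
    refine main_abs Fq N w hN _ ?_ _ _ ?_ ?_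
    · intro t hv hg hwt
      apply Submodule.subset_span
      obtain ⟨m, a, rfl⟩ : ∃ (m : ℕ) (a : Fin m → ℕ × Fb Fq), t = List.ofFn a :=
        ⟨t.length, t.get, (List.ofFn_get t).symm⟩
      cases m with
      | zero => simp [Good] at hg
      | succ m =>
        obtain ⟨h1, h2⟩ := good_iff m a hg
        have hp : ∀ i, 0 < (a i).1 ∧ (a i).2 ^ N = 1 := fun i => hv _ ((List.mem_ofFn).2 ⟨i, rfl⟩)
        refine ⟨⟨m + 1, fun i => (a i).1, fun i => (a i).2⟩, ⟨fun i => (hp i).1, fun i => (hp i).2⟩,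
          ⟨Nat.succ_pos _, ?_, fun i hi => h1 i hi, fun i hi => h2 i hi⟩, ?_⟩
        · rw [← hwt, wtl, List.map_ofFn, List.sum_ofFn]
          rfl
        · rw [zeta_eq]
    · rw [← List.ofFn_succ (f := fun i => (s i, eps i))]
      intro x hx
      rw [List.mem_ofFn] at hx
      obtain ⟨i, rfl⟩ := hx
      exact ⟨hA.1 i, hA.2 i⟩
    · rw [← List.ofFn_succ (f := fun i => (s i, eps i)), wtl, List.map_ofFn, List.sum_ofFn]
      exact hAw

end Abs

/-- **Weak Brown–Deligne theorem for cyclotomic multiple zeta values**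
(Theorem `weak BD cyclotomic MZV`): every `ζ_A(𝛆;𝔱)` of weight `w` is an `A_N`-linear
combination of the `ζ_A(𝛜;𝔰)` with `𝔰 ∈ T_w`; in particular the latter span `CZ_{N,w}`
over `K_N`. -/
theorem weak_brown_deligne_cyclotomic_MZV
    (Fq : Type) [Field Fq] [Fintype Fq] (N w : ℕ) (hN : 0 < N) (hw : 0 < w) :
    (∀ A : PArr (Fb Fq), A.Positive N → A.wt = w →
      ∃ (m : ℕ) (a : Fin m → Kinf Fq) (U : Fin m → PArr (Fb Fq)),
        (∀ i, a i ∈ AN Fq N) ∧ (∀ i, (U i).Positive N ∧ InTw (qc Fq) w (U i)) ∧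
        zetaA Fq A = ∑ i, a i * zetaA Fq (U i)) ∧
    Submodule.span (KNf Fq N)
        {x | ∃ U : PArr (Fb Fq), U.Positive N ∧ InTw (qc Fq) w U ∧ x = zetaA Fq U}
      = CZ Fq N w := by
  have hZ := Abs.main_Z Fq N w hN hw
  refine ⟨fun A hA hAw => ?_, le_antisymm ?_ ?_⟩
  · obtain ⟨m, f, g, h⟩ := Submodule.mem_span_set'.1 (hZ A hA hAw)
    choose U hU1 hU2 hU3 using fun i => (g i).2
    refine ⟨m, fun i => (f i : Kinf Fq), U, fun i => (f i).2, fun i => ⟨hU1 i, hU2 i⟩, ?_⟩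
    rw [← h]
    refine Finset.sum_congr rfl fun i _ => ?_
    rw [hU3 i]
    rfl
  · refine Submodule.span_le.2 ?_
    rintro x ⟨U, hU1, hU2, rfl⟩
    exact Submodule.subset_span ⟨U, hU1, hU2.2.1, rfl⟩
  · refine Submodule.span_le.2 ?_
    rintro x ⟨A, hA, hAw, rfl⟩
    have hle : AN Fq N ≤ (KNf Fq N).toSubring :=
      Subring.closure_le.2 Subfield.subset_closure
    have := hZ A hA hAw
    refine Submodule.span_induction (p := fun x _ => x ∈ Submodule.span (KNf Fq N)
        {x | ∃ U : PArr (Fb Fq), U.Positive N ∧ InTw (qc Fq) w U ∧ x = zetaA Fq U})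
      (fun x hx => Submodule.subset_span hx) (Submodule.zero_mem _)
      (fun x y _ _ hx hy => Submodule.add_mem _ hx hy) (fun a x _ hx => ?_) this
    exact Submodule.smul_mem _ (⟨a.1, hle a.2⟩ : KNf Fq N) hx

end ZHPC
end
end

section
/- Weak Brown–Deligne theorem for Carlitz multiple polylogarithms at roots of unity: for every positive array (𝛆;𝔱) of weight w, the value Li(𝛆;𝔱) is an A_N-linear combination of the values Li(𝛜;𝔰) with 𝔰 ∈ T_w and 𝛜 ∈ Γ_N^{depth(𝔰)}. In particular, the set {Li(𝛜;𝔰) : 𝔰 ∈ T_w, 𝛜 ∈ Γ_N^{depth(𝔰)}} spans CL_{N,w} over K_N. -/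
noncomputable section

open scoped Classical

namespace ZHPC

variable (Fq : Type) [Field Fq] [Fintype Fq]

set_option synthInstance.maxHeartbeats 1000000


section Algebra

set_option linter.unusedSectionVars false

variable {K E : Type} [Field K] [Monoid E]

/-- Partial sums of a word. -/
def FF (c : ℕ × E → ℕ → K) : List (ℕ × E) → ℕ → K
  | [], _ => 1
  | x :: V, d => ∑ j ∈ Finset.range d, c x j * FF c V j

/-- Linear combinations. -/
def lin (c : ℕ × E → ℕ → K) (C : List (K × List (ℕ × E))) (d : ℕ) : K :=
  (C.map (fun p => p.1 * FF c p.2 d)).sum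

/-- stuffle with one letter -/
def stf (x : ℕ × E) : List (ℕ × E) → List (List (ℕ × E))
  | [] => [[x]]
  | v :: V => (x :: v :: V) :: ((x.1 + v.1, x.2 * v.2) :: V) :: (stf x V).map (List.cons v)

/-- weight -/
def wl (W : List (ℕ × E)) : ℕ := (W.map Prod.fst).sum

/-- positivity -/
def PosL (N : ℕ) (W : List (ℕ × E)) : Prop := ∀ x ∈ W, 0 < x.1 ∧ x.2 ^ N = 1

lemma FF_cons_succ (c : ℕ × E → ℕ → K) (x : ℕ × E) (V : List (ℕ × E)) (d : ℕ) :
    FF c (x :: V) (d + 1) = FF c (x :: V) d + c x d * FF c V d := by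
  simp [FF, Finset.sum_range_succ]

lemma FF_cons_zero (c : ℕ × E → ℕ → K) (x : ℕ × E) (V : List (ℕ × E)) :
    FF c (x :: V) 0 = 0 := by
  simp [FF]

lemma lin_cons (c : ℕ × E → ℕ → K) (a : K) (W : List (ℕ × E)) (C : List (K × List (ℕ × E)))
    (d : ℕ) : lin c ((a, W) :: C) d = a * FF c W d + lin c C d := by
  simp [lin]

lemma lin_nil (c : ℕ × E → ℕ → K) (d : ℕ) : lin c [] d = 0 := by
  simp [lin]

lemma lin_append (c : ℕ × E → ℕ → K) (C C' : List (K × List (ℕ × E)))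
    (d : ℕ) : lin c (C ++ C') d = lin c C d + lin c C' d := by
  simp [lin]

/-- prefix a letter -/
def pre (P : List (ℕ × E)) (C : List (K × List (ℕ × E))) : List (K × List (ℕ × E)) :=
  C.map (fun p => (p.1, P ++ p.2))

lemma lin_pre_cons (c : ℕ × E → ℕ → K) (x : ℕ × E) (C : List (K × List (ℕ × E))) (d : ℕ) :
    lin c (pre [x] C) d = ∑ j ∈ Finset.range d, c x j * lin c C j := by
  induction C with
  | nil => simp [pre, lin]
  | cons p C ih =>
    have : pre [x] (p :: C) = (p.1, x :: p.2) :: pre [x] C := rfl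
    rw [this, lin_cons, ih]
    obtain ⟨a, W⟩ := p
    simp only [lin_cons, mul_add, Finset.sum_add_distrib, FF, Finset.mul_sum]
    congr 1
    refine Finset.sum_congr rfl fun j _ => by ring

lemma pre_pre (P P' : List (ℕ × E)) (C : List (K × List (ℕ × E))) :
    pre P (pre P' C) = pre (P ++ P') C := by
  simp [pre]

lemma lin_prefix (c : ℕ × E → ℕ → K) (X : List (ℕ × E)) (C : List (K × List (ℕ × E)))
    (h : ∀ d, FF c X d = lin c C d) (P : List (ℕ × E)) (d : ℕ) :
    FF c (P ++ X) d = lin c (pre P C) d := by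
  induction P generalizing d with
  | nil => simpa [pre] using h d
  | cons x P ih =>
    have : pre (x :: P) C = pre [x] (pre P C) := by rw [pre_pre]; rfl
    rw [this, lin_pre_cons]
    simp only [List.cons_append, FF]
    exact Finset.sum_congr rfl fun j _ => by rw [ih]

/-- sum over a list of words -/
def sm (c : ℕ × E → ℕ → K) (Y : List (List (ℕ × E))) (d : ℕ) : K :=
  (Y.map (fun W => FF c W d)).sum

lemma sm_cons (c : ℕ × E → ℕ → K) (W) (Y : List (List (ℕ × E))) (d : ℕ) :
    sm c (W :: Y) d = FF c W d + sm c Y d := by simp [sm]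

lemma sm_map_cons (c : ℕ × E → ℕ → K) (x : ℕ × E) (Y : List (List (ℕ × E))) (d : ℕ) :
    sm c (Y.map (List.cons x)) d = ∑ j ∈ Finset.range d, c x j * sm c Y j := by
  induction Y with
  | nil => simp [sm]
  | cons W Y ih =>
    rw [List.map_cons, sm_cons, ih]
    simp only [sm_cons, FF, mul_add, Finset.sum_add_distrib]

lemma lin_of_map (c : ℕ × E → ℕ → K) (u : K) (Y : List (List (ℕ × E))) (d : ℕ) :
    lin c (Y.map (fun W => (u, W))) d = u * sm c Y d := by
  induction Y with
  | nil => simp [sm, lin]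
  | cons W Y ih => rw [List.map_cons, lin_cons, ih, sm_cons]; ring

lemma stf_spec (c : ℕ × E → ℕ → K)
    (hc : ∀ x y : ℕ × E, ∀ j, c (x.1 + y.1, x.2 * y.2) j = c x j * c y j)
    (x : ℕ × E) (V : List (ℕ × E)) (d : ℕ) :
    sm c (stf x V) d = FF c [x] d * FF c V d := by
  induction V generalizing d with
  | nil => simp [stf, sm, FF]
  | cons v V ih =>
    induction d with
    | zero =>
      rw [stf, sm_cons, sm_cons, sm_map_cons]
      simp [FF_cons_zero]
    | succ d ihd =>
      rw [stf, sm_cons, sm_cons, sm_map_cons] at ihd ⊢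
      rw [Finset.sum_range_succ, FF_cons_succ, FF_cons_succ, FF_cons_succ c x [],
        FF_cons_succ c v V, hc, ih]
      have e : FF c [] d = 1 := rfl
      rw [e]
      linear_combination ihd

lemma wl_cons (x : ℕ × E) (V : List (ℕ × E)) : wl (x :: V) = x.1 + wl V := by simp [wl]

lemma wl_append (P V : List (ℕ × E)) : wl (P ++ V) = wl P + wl V := by simp [wl]

lemma posL_cons (N : ℕ) (x : ℕ × E) (V : List (ℕ × E)) :
    PosL N (x :: V) ↔ (0 < x.1 ∧ x.2 ^ N = 1) ∧ PosL N V := by simp [PosL]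

lemma posL_append (N : ℕ) (P V : List (ℕ × E)) :
    PosL N (P ++ V) ↔ PosL N P ∧ PosL N V := by
  simp only [PosL, List.mem_append]
  constructor
  · intro h; exact ⟨fun x hx => h x (Or.inl hx), fun x hx => h x (Or.inr hx)⟩
  · rintro ⟨h1, h2⟩ x (hx | hx)
    · exact h1 x hx
    · exact h2 x hx

lemma stf_mem (N : ℕ) (x : ℕ) (hx : 0 < x) (V : List (ℕ × E)) (hV : PosL N V) :
    ∀ Y ∈ stf (x, 1) V, PosL N Y ∧ wl Y = x + wl V ∧ V.length ≤ Y.length ∧ 1 ≤ Y.length := by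
  induction V with
  | nil => simp [stf, PosL, wl, hx]
  | cons v V ih =>
    rw [posL_cons] at hV
    intro Y hY
    simp only [stf, List.mem_cons, List.mem_map] at hY
    rcases hY with rfl | rfl | ⟨Z, hZ, rfl⟩
    · simp [posL_cons, wl_cons, hV, hx]
    · simp [posL_cons, wl_cons, hV, hx]; omega
    · have := ih hV.2 Z hZ
      simp [posL_cons, wl_cons, hV, this]; omega

/-- The key relation for tails. -/
lemma tail_rel (c : ℕ × E → ℕ → K)
    (hc : ∀ x y : ℕ × E, ∀ j, c (x.1 + y.1, x.2 * y.2) j = c x j * c y j)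
    (q : ℕ) (e : E) (u : K)
    (hkey : ∀ d, c (q, e) d = u * c (1, e) (d + 1) * FF c [(q - 1, 1)] (d + 1))
    (V : List (ℕ × E)) (D : ℕ) :
    ∑ d ∈ Finset.range D, c (q, e) d * FF c V (d + 1) =
      u * sm c ((stf (q - 1, 1) V).map (List.cons (1, e))) (D + 1) := by
  rw [sm_map_cons, Finset.sum_range_succ', stf_spec c hc, FF_cons_zero]
  simp only [zero_mul, mul_zero, add_zero, Finset.mul_sum]
  refine Finset.sum_congr rfl fun d _ => ?_
  rw [stf_spec c hc, hkey d]; ring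

/-- bad tails -/
def Bad (q : ℕ) (X : List (ℕ × E)) : Prop :=
  (∃ e, X = [(q, e)]) ∨ ∃ v e V, 0 < v ∧ X = (q + v, e) :: V

lemma bad_rel (c : ℕ × E → ℕ → K)
    (hc : ∀ x y : ℕ × E, ∀ j, c (x.1 + y.1, x.2 * y.2) j = c x j * c y j)
    (q N : ℕ) (hq : 2 ≤ q) (S : Subring K)
    (hkey : ∀ e : E, e ^ N = 1 → ∃ u ∈ S,
      ∀ d, c (q, e) d = u * c (1, e) (d + 1) * FF c [(q - 1, 1)] (d + 1))
    (X : List (ℕ × E)) (hX : PosL N X) (hb : Bad q X) :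
    ∃ (C : List (K × List (ℕ × E))) (e : E) (u : K) (Y : List (List (ℕ × E))),
      e ^ N = 1 ∧ u ∈ S ∧
      (∀ p ∈ C, p.1 ∈ S ∧ PosL N p.2 ∧ wl p.2 = wl X ∧ p.2.length = X.length + 1) ∧
      (∀ Z ∈ Y, PosL N Z ∧ wl Z + 1 = wl X ∧ X.length ≤ Z.length) ∧
      ∀ D, FF c X D = lin c C D + u * sm c (Y.map (List.cons (1, e))) (D + 1) := by
  rcases hb with ⟨e, rfl⟩ | ⟨v, e, V, hv, rfl⟩
  · have he : e ^ N = 1 := ((posL_cons _ _ _).1 hX).1.2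
    obtain ⟨u, hu, hk⟩ := hkey e he
    refine ⟨[], e, u, stf (q - 1, 1) [], he, hu, by simp, ?_, ?_⟩
    · intro Z hZ
      have := stf_mem (E := E) N (q - 1) (by omega) [] (by simp [PosL]) Z hZ
      refine ⟨this.1, ?_, by simpa using this.2.2.2⟩
      rw [this.2.1]; simp [wl]; omega
    · intro D
      rw [← tail_rel c hc q e u hk [] D, lin_nil]
      simp [FF]
  · have h1 := (posL_cons _ _ _).1 hX
    have he : e ^ N = 1 := h1.1.2
    obtain ⟨u, hu, hk⟩ := hkey e he
    have hpv : PosL N ((v, 1) :: V) := by rw [posL_cons]; exact ⟨⟨hv, by simp⟩, h1.2⟩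
    refine ⟨[(-1, (q, e) :: (v, 1) :: V)], e, u, stf (q - 1, 1) ((v, 1) :: V), he, hu, ?_, ?_, ?_⟩
    · intro p hp
      rw [List.mem_singleton] at hp
      subst hp
      refine ⟨S.neg_mem S.one_mem, ?_, ?_, by simp⟩
      · show PosL N (_ :: _)
        rw [posL_cons]
        exact ⟨⟨by show 0 < q; omega, he⟩, hpv⟩
      · simp [wl_cons]; omega
    · intro Z hZ
      have := stf_mem (E := E) N (q - 1) (by omega) _ hpv Z hZ
      refine ⟨this.1, ?_, by simpa using this.2.2.1⟩
      rw [this.2.1]; simp [wl_cons]; omega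
    · intro D
      rw [← tail_rel c hc q e u hk _ D, lin_cons, lin_nil]
      have : ∀ j, c (q + v, e) j = c (q, e) j * c (v, 1) j := fun j => by
        have := hc (q, e) (v, 1) j
        simpa using this
      simp only [FF_cons_succ, mul_add, Finset.sum_add_distrib]
      have e1 : FF c ((q + v, e) :: V) D =
          ∑ d ∈ Finset.range D, c (q, e) d * (c (v, 1) d * FF c V d) := by
        simp only [FF, this, mul_assoc]
      have e2 : FF c ((q, e) :: (v, 1) :: V) D =
          ∑ d ∈ Finset.range D, c (q, e) d * FF c ((v, 1) :: V) d := rfl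
      rw [e1, e2]
      ring

/-- The relation with a nonempty prefix, reduced to one letter. -/
lemma bad_rel_cons (c : ℕ × E → ℕ → K)
    (hc : ∀ x y : ℕ × E, ∀ j, c (x.1 + y.1, x.2 * y.2) j = c x j * c y j)
    (X : List (ℕ × E)) (C : List (K × List (ℕ × E))) (e : E) (u : K) (Y : List (List (ℕ × E)))
    (h : ∀ D, FF c X D = lin c C D + u * sm c (Y.map (List.cons (1, e))) (D + 1))
    (x : ℕ × E) (D : ℕ) :
    FF c (x :: X) D = lin c (pre [x] C ++
      ((Y.map (fun Z => (u, x :: (1, e) :: Z))) ++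
        Y.map (fun Z => (u, (x.1 + 1, x.2 * e) :: Z)))) D := by
  have e1 : Y.map (fun Z => (u, x :: (1, e) :: Z)) =
      ((Y.map (List.cons (1, e))).map (List.cons x)).map (fun W => (u, W)) := by
    simp [Function.comp_def]
  have e2 : Y.map (fun Z => (u, (x.1 + 1, x.2 * e) :: Z)) =
      (Y.map (List.cons (x.1 + 1, x.2 * e))).map (fun W => (u, W)) := by
    simp [Function.comp_def]
  rw [lin_append, lin_append, lin_pre_cons, e1, e2, lin_of_map, lin_of_map,
    sm_map_cons, sm_map_cons]
  simp only [FF, h, mul_add, Finset.sum_add_distrib, Finset.mul_sum]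
  congr 1
  rw [← Finset.sum_add_distrib]
  refine Finset.sum_congr rfl fun j _ => ?_
  rw [sm_map_cons, Finset.sum_range_succ, ← sm_map_cons, hc x (1, e) j]
  ring

/-- lexicographic encoding -/
def enc (b : ℕ) : List (ℕ × E) → ℕ
  | [] => 0
  | x :: l => x.1 * b ^ l.length + enc b l

lemma enc_lt (b : ℕ) (l : List (ℕ × E)) (h : wl l < b) : enc b l < b ^ l.length := by
  induction l with
  | nil => simp [enc]
  | cons x l ih =>
    rw [wl_cons] at h
    have := ih (by omega)
    simp only [enc, List.length_cons, pow_succ]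
    have h2 : (x.1 + 1) * b ^ l.length ≤ b * b ^ l.length := Nat.mul_le_mul_right _ (by omega)
    nlinarith

lemma enc_append_lt (b : ℕ) (P l l' : List (ℕ × E)) (hl : l.length = l'.length)
    (h : enc b l < enc b l') : enc b (P ++ l) < enc b (P ++ l') := by
  induction P with
  | nil => simpa
  | cons x P ih => simp only [List.cons_append, enc, List.length_append, hl]; omega

lemma length_le_wl (N : ℕ) (l : List (ℕ × E)) (h : PosL N l) : l.length ≤ wl l := by
  induction l with
  | nil => simp
  | cons x l ih =>
    rw [posL_cons] at h
    have := ih h.2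
    rw [wl_cons, List.length_cons]; omega

/-- the increasing measure -/
def ms (w : ℕ) (l : List (ℕ × E)) : ℕ := l.length * (w + 1) ^ w + enc (w + 1) l

lemma enc_lt' (N w : ℕ) (l : List (ℕ × E)) (h : PosL N l) (hw : wl l = w) :
    enc (w + 1) l < (w + 1) ^ w := by
  refine (enc_lt _ l (by omega)).trans_le (Nat.pow_le_pow_right (by omega) ?_)
  rw [← hw]; exact length_le_wl N l h

lemma ms_lt_of_length (N w : ℕ) (l l' : List (ℕ × E)) (h : PosL N l) (hw : wl l = w)
    (hl : l.length < l'.length) : ms w l < ms w l' := by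
  have := enc_lt' N w l h hw
  have h2 : (l.length + 1) * (w + 1) ^ w ≤ l'.length * (w + 1) ^ w := Nat.mul_le_mul_right _ hl
  simp only [ms]; nlinarith

lemma ms_bound (N w : ℕ) (l : List (ℕ × E)) (h : PosL N l) (hw : wl l = w) :
    ms w l < (w + 1) * (w + 1) ^ w := by
  have := enc_lt' N w l h hw
  have h2 : l.length * (w + 1) ^ w ≤ w * (w + 1) ^ w :=
    Nat.mul_le_mul_right _ (by rw [← hw]; exact length_le_wl N l h)
  simp only [ms]; nlinarith

/-- One rewriting step. -/
lemma step (c : ℕ × E → ℕ → K)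
    (hc : ∀ x y : ℕ × E, ∀ j, c (x.1 + y.1, x.2 * y.2) j = c x j * c y j)
    (q N : ℕ) (hq : 2 ≤ q) (S : Subring K)
    (hkey : ∀ e : E, e ^ N = 1 → ∃ u ∈ S,
      ∀ d, c (q, e) d = u * c (1, e) (d + 1) * FF c [(q - 1, 1)] (d + 1))
    (hcomm : ∀ x y : E, x ^ N = 1 → y ^ N = 1 → (x * y) ^ N = 1)
    (w : ℕ) (P X : List (ℕ × E)) (hX : PosL N (P ++ X)) (hw : wl (P ++ X) = w) (hb : Bad q X) :
    ∃ C C' : List (K × List (ℕ × E)),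
      (∀ p ∈ C ++ C', p.1 ∈ S ∧ PosL N p.2 ∧ wl p.2 = w ∧ ms w (P ++ X) < ms w p.2) ∧
      ∀ D, FF c (P ++ X) D = lin c C D + lin c C' (D + 1) := by
  have hX' := (posL_append _ _ _).1 hX
  have hw' := hw
  rw [wl_append] at hw'
  obtain ⟨C, e, u, Y, he, hu, hC, hY, hF⟩ := bad_rel c hc q N hq S hkey X hX'.2 hb
  rcases List.eq_nil_or_concat P with rfl | ⟨P, x, rfl⟩
  · refine ⟨C, (Y.map (List.cons (1, e))).map (fun W => (u, W)), ?_, ?_⟩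
    · intro p hp
      rcases List.mem_append.1 hp with hp | hp
      · have := hC p hp
        refine ⟨this.1, this.2.1, ?_, ms_lt_of_length N w _ _ hX hw ?_⟩
        · simp [wl] at *; omega
        · simp; omega
      · simp only [List.map_map, List.mem_map, Function.comp] at hp
        obtain ⟨Z, hZ, rfl⟩ := hp
        have := hY Z hZ
        refine ⟨hu, ?_, ?_, ms_lt_of_length N w _ _ hX hw ?_⟩
        · simp [posL_cons, he, this.1]
        · simp [wl] at *; omega
        · simp; omega
    · intro D
      rw [lin_of_map]; exact hF D
  · have hF2 := bad_rel_cons c hc X C e u Y hF x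
    simp only [List.concat_eq_append] at *
    have hx : (0 < x.1 ∧ x.2 ^ N = 1) := hX'.1 x (by simp)
    have hP : PosL N P := ((posL_append _ _ _).1 hX'.1).1
    rw [wl_append, wl_cons] at hw'
    have hn : wl ([] : List (ℕ × E)) = 0 := rfl
    refine ⟨pre P (pre [x] C ++ (Y.map (fun Z => (u, x :: (1, e) :: Z)) ++
      Y.map (fun Z => (u, (x.1 + 1, x.2 * e) :: Z)))), [], ?_, fun D => ?_⟩
    rotate_left
    · rw [lin_nil, add_zero, List.append_assoc]
      exact lin_prefix c _ _ hF2 P D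
    · intro p hp
      rw [List.append_nil] at hp
      simp only [pre, List.map_append, List.mem_append, List.mem_map, List.map_map,
        Function.comp] at hp
      rcases hp with ⟨p, hp, rfl⟩ | ⟨Z, hZ, rfl⟩ | ⟨Z, hZ, rfl⟩
      · have := hC p hp
        refine ⟨this.1, ?_, ?_, ms_lt_of_length N w _ _ hX hw ?_⟩
        · simp [posL_append, posL_cons, hP, hx, this.2.1]
        · simp only [wl_append, wl_cons]; omega
        · simp; omega
      · have := hY Z hZ
        refine ⟨hu, ?_, ?_, ms_lt_of_length N w _ _ hX hw ?_⟩
        · simp [posL_append, posL_cons, hP, hx, this.1, he]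
        · simp only [wl_append, wl_cons]; omega
        · simp; omega
      · have := hY Z hZ
        refine ⟨hu, ?_, ?_, ?_⟩
        · simp [posL_append, posL_cons, hP, this.1, hcomm _ _ hx.2 he]
        · simp only [wl_append, wl_cons]; omega
        · rcases this.2.2.lt_or_eq with hlt | heq
          · refine ms_lt_of_length N w _ _ hX hw ?_
            simp; omega
          · have hen : enc (w + 1) (P ++ [x] ++ X) <
                enc (w + 1) (P ++ (x.1 + 1, x.2 * e) :: Z) := by
              rw [List.append_assoc]
              apply enc_append_lt
              · simp [heq]
              · have h3 := enc_lt (w + 1) X (by omega)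
                simp only [List.cons_append, List.nil_append, enc, ← heq]
                nlinarith
            have hlen : (P ++ [x] ++ X).length = (P ++ (x.1 + 1, x.2 * e) :: Z).length := by
              simp [heq]
            simp only [ms]
            rw [hlen]
            omega

lemma exists_bad (q : ℕ) (W : List (ℕ × E)) (hW : W ≠ [])
    (h : ¬ ((∀ x ∈ W, x.1 ≤ q) ∧ (W.getLast hW).1 < q)) :
    ∃ P X, W = P ++ X ∧ Bad q X := by
  by_cases h1 : ∀ x ∈ W, x.1 ≤ q
  · have h2 : (W.getLast hW).1 = q := by
      have := h1 _ (List.getLast_mem hW)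
      by_contra h3
      exact h ⟨h1, by omega⟩
    refine ⟨W.dropLast, [W.getLast hW], (List.dropLast_append_getLast hW).symm, Or.inl ?_⟩
    exact ⟨(W.getLast hW).2, by rw [← h2]⟩
  · push Not at h1
    obtain ⟨x, hx, hq⟩ := h1
    obtain ⟨P, V, rfl⟩ := List.append_of_mem hx
    refine ⟨P, x :: V, rfl, Or.inr ⟨x.1 - q, x.2, V, by omega, ?_⟩⟩
    congr 1
    ext
    · simp; omega
    · simp

end Algebra

section Analysis

set_option linter.unusedSectionVars false

open Filter Topology WithZero

/-- the basic term -/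
def cc (x : ℕ × Fb Fq) (j : ℕ) : Kinf Fq := cst Fq (x.2 ^ j) / ell Fq j ^ x.1

lemma cc_mul (x y : ℕ × Fb Fq) (j : ℕ) :
    cc Fq (x.1 + y.1, x.2 * y.2) j = cc Fq x j * cc Fq y j := by
  simp only [cc, mul_pow, map_mul, pow_add]
  rw [div_mul_div_comm]

lemma two_le_qc : 2 ≤ qc Fq := Fintype.one_lt_card

lemma v_theta : Valued.v (theta Fq) = exp (1 : ℤ) := by
  rw [theta, LaurentSeries.valuation_single_zpow]; simp

lemma v_theta_sub (i : ℕ) (hi : 1 ≤ i) :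
    Valued.v (theta Fq - theta Fq ^ qc Fq ^ i) = exp ((qc Fq ^ i : ℕ) : ℤ) := by
  have h1 : 1 < qc Fq ^ i := Nat.one_lt_pow (by omega) (two_le_qc Fq)
  have h2 : Valued.v (theta Fq ^ qc Fq ^ i) = exp ((qc Fq ^ i : ℕ) : ℤ) := by
    rw [map_pow, v_theta, ← exp_nsmul]; simp
  rw [Valuation.map_sub_eq_of_lt_right, h2]
  rw [h2, v_theta, exp_lt_exp]
  exact_mod_cast h1

lemma ell_zero : ell Fq 0 = 1 := by simp [ell]

lemma ell_succ (d : ℕ) :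
    ell Fq (d + 1) = ell Fq d * (theta Fq - theta Fq ^ qc Fq ^ (d + 1)) := by
  simp only [ell]
  rw [Finset.prod_Icc_succ_top (by omega)]

lemma v_ell (d : ℕ) : exp (d : ℤ) ≤ Valued.v (ell Fq d) := by
  induction d with
  | zero => simp [ell_zero]
  | succ d ih =>
    rw [ell_succ, map_mul, v_theta_sub _ _ (by omega), Nat.cast_succ, exp_add]
    refine mul_le_mul' ih ?_
    rw [exp_le_exp]
    exact_mod_cast Nat.one_le_pow _ _ (by have := two_le_qc Fq; omega)

lemma ell_ne_zero (d : ℕ) : ell Fq d ≠ 0 := by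
  intro h
  have := v_ell Fq d
  rw [h, map_zero] at this
  exact absurd this (by simp)

lemma v_cst_le (a : Fb Fq) : Valued.v (cst Fq a) ≤ 1 := by
  have : (1 : ℤᵐ⁰) = exp (-(0 : ℤ)) := by simp
  rw [this, LaurentSeries.valuation_le_iff_coeff_lt_eq_zero]
  intro n hn
  simp only [cst, HahnSeries.C_apply]
  exact HahnSeries.coeff_single_of_ne hn.ne

lemma aux_le (a b : ℤᵐ⁰) (n : ℕ) (hn : 0 < n) (hb : 1 ≤ b) (h : b ≤ a) : b ≤ a ^ n :=
  h.trans (le_self_pow₀ (hb.trans h) hn.ne')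

lemma aux_div (a b g : ℤᵐ⁰) (h0 : 0 < b) (h : b ≤ g) (ha : a ≤ 1) : a / g ≤ b⁻¹ := by
  rw [div_eq_mul_inv]
  calc _ ≤ 1 * b⁻¹ := mul_le_mul' ha (inv_anti₀ h0 h)
    _ = _ := one_mul _

lemma v_cc (x : ℕ × Fb Fq) (hx : 0 < x.1) (j : ℕ) : Valued.v (cc Fq x j) ≤ exp (-(j : ℤ)) := by
  rw [cc, map_div₀, exp_neg]
  have h1 : (1 : ℤᵐ⁰) ≤ exp (j : ℤ) := by
    rw [← exp_zero, exp_le_exp]; positivity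
  have h2 : exp (j : ℤ) ≤ Valued.v (ell Fq j) ^ x.1 :=
    aux_le _ _ _ hx h1 (v_ell Fq j)
  refine aux_div _ _ _ (by simp) ?_ (v_cst_le Fq (x.2 ^ j))
  rw [map_pow]; exact h2

lemma frob_sub (a b : Kinf Fq) : (a - b) ^ qc Fq = a ^ qc Fq - b ^ qc Fq := by
  obtain ⟨p, hchar, n, hp, hcard⟩ := FiniteField.card' Fq
  have : Fact p.Prime := ⟨hp⟩
  have : CharP (Kinf Fq) p :=
    charP_of_injective_ringHom ((cst Fq).comp (algebraMap Fq (Fb Fq))).injective p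
  rw [qc, hcard]
  exact sub_pow_char_pow a b _

lemma ell_pow_succ (d : ℕ) : ell Fq (d + 1) ^ qc Fq =
    ell Fq d ^ qc Fq * (theta Fq ^ qc Fq - theta Fq ^ qc Fq ^ (d + 2)) := by
  rw [ell_succ, mul_pow, frob_sub, ← pow_mul, ← pow_succ]

lemma ell_key (d : ℕ) : ell Fq (d + 1) = (theta Fq - theta Fq ^ qc Fq) * ell Fq d ^ qc Fq *
    ∑ j ∈ Finset.range (d + 1), (ell Fq j ^ (qc Fq - 1))⁻¹ := by
  induction d with
  | zero => simp [ell_succ, ell_zero]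
  | succ d ih =>
    rw [Finset.sum_range_succ, mul_add]
    have h1 : ell Fq (d + 1) ^ qc Fq * (ell Fq (d + 1) ^ (qc Fq - 1))⁻¹ = ell Fq (d + 1) := by
      have : ell Fq (d + 1) ^ qc Fq = ell Fq (d + 1) ^ (qc Fq - 1) * ell Fq (d + 1) := by
        rw [← pow_succ, Nat.sub_add_cancel (by have := two_le_qc Fq; omega)]
      rw [this, mul_comm, ← mul_assoc, inv_mul_cancel₀ (pow_ne_zero _ (ell_ne_zero _ _)), one_mul]
    rw [mul_assoc _ _ (_⁻¹), h1, ell_pow_succ, ell_succ Fq (d + 1)]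
    linear_combination (theta Fq ^ qc Fq - theta Fq ^ qc Fq ^ (d + 2)) * ih

lemma cst_mem_AN (N : ℕ) (a : Fb Fq) (ha : a ∈ kN Fq N) : cst Fq a ∈ AN Fq N :=
  Subring.subset_closure (Or.inl ⟨a, ha, rfl⟩)

lemma theta_mem_AN (N : ℕ) : theta Fq ∈ AN Fq N :=
  Subring.subset_closure (Or.inr rfl)

lemma AN_le_KNf (N : ℕ) (a : Kinf Fq) (ha : a ∈ AN Fq N) : a ∈ KNf Fq N := by
  have : AN Fq N ≤ (KNf Fq N).toSubring := by
    rw [AN, Subring.closure_le]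
    exact Subfield.subset_closure
  exact this ha

lemma cc_key (N : ℕ) (hN : 0 < N) (e : Fb Fq) (he : e ^ N = 1) : ∃ u ∈ AN Fq N,
    ∀ d, cc Fq (qc Fq, e) d =
      u * cc Fq (1, e) (d + 1) * FF (cc Fq) [(qc Fq - 1, 1)] (d + 1) := by
  have he0 : e ≠ 0 := by
    rintro rfl
    rw [zero_pow hN.ne'] at he
    exact zero_ne_one he
  refine ⟨(theta Fq - theta Fq ^ qc Fq) * cst Fq e⁻¹, ?_, fun d => ?_⟩
  · refine Subring.mul_mem _ (Subring.sub_mem _ (theta_mem_AN _ _)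
      (Subring.pow_mem _ (theta_mem_AN _ _) _)) (cst_mem_AN _ _ _ (Subfield.inv_mem _ ?_))
    exact Subfield.subset_closure (Or.inr he)
  · have h1 : FF (cc Fq) [(qc Fq - 1, 1)] (d + 1) =
        ∑ j ∈ Finset.range (d + 1), (ell Fq j ^ (qc Fq - 1))⁻¹ := by
      simp [FF, cc]
    have h2 := ell_key Fq d
    have h3 := ell_ne_zero Fq (d + 1)
    have h4 : ell Fq d ^ qc Fq ≠ 0 := pow_ne_zero _ (ell_ne_zero Fq d)
    rw [h1]
    simp only [cc, pow_one]
    have h5 : cst Fq (e ^ d) = cst Fq e⁻¹ * cst Fq (e ^ (d + 1)) := by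
      rw [← map_mul, pow_succ', inv_mul_cancel_left₀ he0]
    rw [h5, div_eq_iff h4, mul_div_assoc', div_mul_eq_mul_div, div_mul_eq_mul_div, eq_div_iff h3]
    linear_combination cst Fq e⁻¹ * cst Fq (e ^ (d + 1)) * h2

lemma strictAnti_cons_iff {n : ℕ} (a : ℕ) (g : Fin n → ℕ) :
    StrictAnti (Fin.cons a g : Fin (n + 1) → ℕ) ↔ (∀ i, g i < a) ∧ StrictAnti g := by
  constructor
  · intro h
    refine ⟨fun i => ?_, fun i j hij => ?_⟩
    · simpa using h (Fin.succ_pos i)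
    · simpa using h (Fin.succ_lt_succ_iff.2 hij)
  · rintro ⟨h1, h2⟩ i j hij
    induction i using Fin.cases with
    | zero =>
      induction j using Fin.cases with
      | zero => exact absurd hij (lt_irrefl _)
      | succ j => simpa using h1 j
    | succ i =>
      induction j using Fin.cases with
      | zero => exact absurd hij (by simp)
      | succ j => simpa using h2 (Fin.succ_lt_succ_iff.1 hij)

/-- bounded decreasing tuples -/
def bt (n d : ℕ) : Finset (Fin n → ℕ) :=
  (Fintype.piFinset fun _ => Finset.range d).filter StrictAnti

lemma mem_bt (n d : ℕ) (f : Fin n → ℕ) : f ∈ bt n d ↔ (∀ i, f i < d) ∧ StrictAnti f := by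
  simp [bt]

lemma sum_bt (n : ℕ) (x : Fin n → ℕ × Fb Fq) (d : ℕ) :
    ∑ f ∈ bt n d, ∏ i, cc Fq (x i) (f i) = FF (cc Fq) (List.ofFn x) d := by
  induction n generalizing d with
  | zero =>
    have : bt 0 d = {Fin.elim0} := by
      ext f
      simp only [mem_bt, Finset.mem_singleton]
      exact ⟨fun _ => Subsingleton.elim _ _, fun _ => ⟨fun i => i.elim0, fun i => i.elim0⟩⟩
    rw [this]; simp [FF]
  | succ n ih =>
    rw [List.ofFn_succ, FF]
    simp only [← ih, Finset.mul_sum]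
    rw [Finset.sum_sigma']
    refine Finset.sum_bij' (fun f _ => ⟨f 0, Fin.tail f⟩) (fun p _ => Fin.cons p.1 p.2) ?_ ?_ ?_ ?_ ?_
    · intro f hf
      rw [mem_bt] at hf
      rw [Finset.mem_sigma, mem_bt, Finset.mem_range]
      have := hf.2
      rw [← Fin.cons_self_tail f, strictAnti_cons_iff] at this
      exact ⟨hf.1 0, this⟩
    · intro p hp
      rw [Finset.mem_sigma, mem_bt, Finset.mem_range] at hp
      rw [mem_bt, strictAnti_cons_iff]
      refine ⟨fun i => ?_, hp.2⟩
      induction i using Fin.cases with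
      | zero => simpa using hp.1
      | succ i => simpa using (hp.2.1 i).trans hp.1
    · intro f _; exact Fin.cons_self_tail f
    · intro p _; simp
    · intro f _; rw [Fin.prod_univ_succ]; rfl

lemma nonarch : NonarchimedeanAddGroup (Kinf Fq) where
  is_nonarchimedean U hU := by
    obtain ⟨γ, hγ⟩ := Valued.mem_nhds_zero.1 hU
    have hm : {x : Kinf Fq | Valued.v.restrict x < γ.1} ∈ 𝓝 (0 : Kinf Fq) :=
      Valued.mem_nhds_zero.2 ⟨γ, le_rfl⟩
    let H : AddSubgroup (Kinf Fq) :=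
      { carrier := {x : Kinf Fq | Valued.v.restrict x < γ.1}
        zero_mem' := mem_of_mem_nhds hm
        add_mem' := fun {a b} ha hb => by
          show Valued.v.restrict (a + b) < γ.1
          exact Valuation.map_add_lt _ ha hb
        neg_mem' := fun {a} ha => by
          show Valued.v.restrict (-a) < γ.1
          rw [Valuation.map_neg]; exact ha }
    exact ⟨⟨H, H.isOpen_of_mem_nhds hm⟩, hγ⟩

lemma summable_Li (n : ℕ) (x : Fin n → ℕ × Fb Fq) (hx : ∀ i, 0 < (x i).1) :
    Summable (fun f : {f : Fin n → ℕ // StrictAnti f} => ∏ i, cc Fq (x i) (f.1 i)) := by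
  have := nonarch Fq
  apply NonarchimedeanAddGroup.summable_of_tendsto_cofinite_zero
  rw [tendsto_def]
  intro U hU
  obtain ⟨γ, hγ⟩ := Valued.mem_nhds_zero.1 hU
  rw [mem_cofinite]
  obtain ⟨D, hD⟩ : ∃ D : ℕ, ∀ y : Kinf Fq, Valued.v y ≤ exp (-(D : ℤ)) → y ∈ U := by
    set g := MonoidWithZeroHom.ValueGroup₀.embedding γ.1 with hg
    have hg0 : g ≠ 0 := by simp [hg]
    refine ⟨(1 - log g).toNat, fun y hy => hγ ?_⟩
    show Valued.v.restrict y < γ.1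
    rw [Valuation.restrict_lt_iff_lt_embedding]
    refine hy.trans_lt ?_
    rw [← lt_log_iff_exp_lt hg0]
    omega
  refine Set.Finite.subset (s := {f | f.1 ∈ bt n D}) ?_ ?_
  · exact Set.Finite.preimage Subtype.val_injective.injOn (bt n D).finite_toSet
  · intro f hf
    simp only [Set.mem_compl_iff, Set.mem_preimage] at hf
    show f.1 ∈ bt n D
    rw [mem_bt]
    refine ⟨fun i => ?_, f.2⟩
    by_contra hi
    apply hf
    apply hD
    rw [← Finset.mul_prod_erase _ _ (Finset.mem_univ i), map_mul, map_prod]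
    refine (mul_le_of_le_one_right' (Finset.prod_le_one' fun j _ => ?_)).trans
      ((v_cc Fq _ (hx i) _).trans ?_)
    · refine (v_cc Fq _ (hx j) _).trans ?_
      rw [← exp_zero, exp_le_exp]; simp
    · rw [exp_le_exp]; omega

lemma tendsto_bt (n : ℕ) : Tendsto (fun d => (bt n d).subtype StrictAnti) atTop atTop := by
  apply tendsto_atTop_finset_of_monotone
  · intro d d' hd f hf
    rw [Finset.mem_subtype, mem_bt] at hf ⊢
    exact ⟨fun i => (hf.1 i).trans_le hd, hf.2⟩
  · intro f
    refine ⟨(∑ i, f.1 i) + 1, ?_⟩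
    rw [Finset.mem_subtype, mem_bt]
    exact ⟨fun i => Nat.lt_succ_of_le
      (Finset.single_le_sum (f := f.1) (fun _ _ => Nat.zero_le _) (Finset.mem_univ i)), f.2⟩

lemma tendsto_gen {G : Type} [AddCommMonoid G] [TopologicalSpace G] (n : ℕ)
    (g : (Fin n → ℕ) → G) (s : G)
    (h : HasSum (fun f : {f : Fin n → ℕ // StrictAnti f} => g f.1) s) :
    Tendsto (fun d => ∑ f ∈ bt n d, g f) atTop (𝓝 s) := by
  rw [HasSum, SummationFilter.unconditional_filter] at h
  have h2 : Tendsto (fun d => ∑ f ∈ (bt n d).subtype StrictAnti, g f.1) atTop (𝓝 s) :=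
    h.comp (tendsto_bt n)
  refine h2.congr fun d => ?_
  exact Finset.sum_subtype_of_mem g (fun f hf => ((mem_bt _ _ _).1 hf).2)

lemma Li_eq (A : PArr (Fb Fq)) : Li Fq A = ∑' f : {f : Fin A.depth → ℕ // StrictAnti f},
      ∏ i, cc Fq (A.s i, A.eps i) (f.1 i) := by
  unfold Li cc
  rfl

lemma tendsto_Li (A : PArr (Fb Fq)) (hA : ∀ i, 0 < A.s i) :
    Tendsto (FF (cc Fq) (List.ofFn fun i => (A.s i, A.eps i))) atTop (𝓝 (Li Fq A)) := by
  have h := (summable_Li Fq A.depth (fun i => (A.s i, A.eps i)) hA).hasSum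
  rw [← Li_eq Fq A] at h
  have h2 := tendsto_gen A.depth (fun f => ∏ i, cc Fq (A.s i, A.eps i) (f i)) _ h
  have h3 : (fun d => ∑ f ∈ bt A.depth d, ∏ i, cc Fq (A.s i, A.eps i) (f i)) =
      FF (cc Fq) (List.ofFn fun i => (A.s i, A.eps i)) :=
    funext fun d => sum_bt Fq A.depth (fun i => (A.s i, A.eps i)) d
  rw [← h3]
  exact h2

/-- array of a word -/
def toArr (W : List (ℕ × Fb Fq)) : PArr (Fb Fq) :=
  ⟨W.length, fun i => (W.get i).1, fun i => (W.get i).2⟩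

lemma tendsto_toArr (N : ℕ) (W : List (ℕ × Fb Fq)) (hW : PosL N W) :
    Tendsto (FF (cc Fq) W) atTop (𝓝 (Li Fq (toArr Fq W))) := by
  have h := tendsto_Li Fq (toArr Fq W) (fun i => (hW _ (List.get_mem W i)).1)
  have h2 : (List.ofFn fun i => ((toArr Fq W).s i, (toArr Fq W).eps i)) = W := List.ofFn_get W
  rw [h2] at h
  exact h

lemma lin_gen {K E : Type} [Field K] [Monoid E] [TopologicalSpace K] [IsTopologicalRing K]
    (c : ℕ × E → ℕ → K) (L : List (ℕ × E) → K) (C : List (K × List (ℕ × E)))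
    (h : ∀ p ∈ C, Tendsto (FF c p.2) atTop (𝓝 (L p.2))) :
    Tendsto (lin c C) atTop (𝓝 ((C.map (fun p => p.1 * L p.2)).sum)) := by
  induction C with
  | nil =>
    have : lin c ([] : List (K × List (ℕ × E))) = fun _ => 0 := by funext d; simp [lin]
    rw [this]; simpa using tendsto_const_nhds
  | cons p C ih =>
    have h1 := ih (fun p hp => h p (List.mem_cons_of_mem _ hp))
    have h2 := (h p List.mem_cons_self).const_mul p.1
    have h3 := h2.add h1
    have : lin c (p :: C) = fun d => p.1 * FF c p.2 d + lin c C d := by funext d; simp [lin]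
    rw [this]; simpa using h3

lemma step_lim {K E : Type} [Field K] [Monoid E] [TopologicalSpace K] [IsTopologicalRing K]
    [T2Space K] (c : ℕ × E → ℕ → K) (L : List (ℕ × E) → K) (C C' : List (K × List (ℕ × E)))
    (h : ∀ p ∈ C ++ C', Tendsto (FF c p.2) atTop (𝓝 (L p.2))) (W : List (ℕ × E))
    (hW : Tendsto (FF c W) atTop (𝓝 (L W)))
    (hr : ∀ D, FF c W D = lin c C D + lin c C' (D + 1)) :
    L W = ((C ++ C').map (fun p => p.1 * L p.2)).sum := by
  have h1 := lin_gen c L C (fun p hp => h p (List.mem_append_left _ hp))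
  have h2 := lin_gen c L C' (fun p hp => h p (List.mem_append_right _ hp))
  have h3 := h1.add (h2.comp (tendsto_add_atTop_nat 1))
  have h4 : Tendsto (FF c W) atTop (𝓝 ((C.map (fun p => p.1 * L p.2)).sum +
      (C'.map (fun p => p.1 * L p.2)).sum)) := h3.congr fun d => (hr d).symm
  rw [tendsto_nhds_unique hW h4, List.map_append, List.sum_append]

lemma induct {K E : Type} [Field K] [Monoid E] [TopologicalSpace K] [IsTopologicalRing K]
    [T2Space K] (c : ℕ × E → ℕ → K) (L : List (ℕ × E) → K)
    (hc : ∀ (x y : ℕ × E) j, c (x.1 + y.1, x.2 * y.2) j = c x j * c y j)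
    (q N : ℕ) (hq : 2 ≤ q) (S : Subring K)
    (hkey : ∀ e, e ^ N = 1 → ∃ u ∈ S, ∀ d,
      c (q, e) d = u * c (1, e) (d + 1) * FF c [(q - 1, 1)] (d + 1))
    (hcomm : ∀ x y : E, x ^ N = 1 → y ^ N = 1 → (x * y) ^ N = 1) 
    (hL : ∀ W, PosL N W → Tendsto (FF c W) atTop (𝓝 (L W)))
    (w : ℕ) (hw : 0 < w) (M : Submodule S K)
    (hM : ∀ W, PosL N W → wl W = w → (∀ hW : W ≠ [], (∀ x ∈ W, x.1 ≤ q) →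
      (W.getLast hW).1 < q → L W ∈ M)) (n : ℕ) :
    ∀ W, PosL N W → wl W = w → (w + 1) * (w + 1) ^ w - ms w W ≤ n → L W ∈ M := by
  induction n with
  | zero => 
    intro W h1 h2 h3
    have := ms_bound N w W h1 h2
    omega
  | succ n ih =>
    intro W h1 h2 h3
    have hne : W ≠ [] := by
      rintro rfl
      simp [wl] at h2; omega
    by_cases hg : (∀ x ∈ W, x.1 ≤ q) ∧ (W.getLast hne).1 < q
    · exact hM W h1 h2 hne hg.1 hg.2
    · obtain ⟨P, X, rfl, hb⟩ := exists_bad q W hne hg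
      obtain ⟨C, C', hC, hr⟩ := step c hc q N hq S hkey hcomm w P X h1 h2 hb
      rw [step_lim c L C C' (fun p hp => hL _ (hC p hp).2.1) _ (hL _ h1) hr]
      refine list_sum_mem ?_
      intro x hx
      obtain ⟨p, hp, rfl⟩ := List.mem_map.1 hx
      obtain ⟨a1, a2, a3, a4⟩ := hC p hp
      have := ms_bound N w _ h1 h2
      exact M.smul_mem (⟨p.1, a1⟩ : S) (ih _ a2 a3 (by omega))

lemma span_fin {K : Type} [Field K] {ι : Type} (S : Subring K) (L : ι → K) (p : ι → Prop) (x : K)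
    (hx : x ∈ Submodule.span S {x | ∃ U, p U ∧ x = L U}) :
    ∃ (m : ℕ) (a : Fin m → K) (U : Fin m → ι), (∀ i, a i ∈ S) ∧ (∀ i, p (U i)) ∧
      x = ∑ i, a i * L (U i) := by
  obtain ⟨m, f, g, h⟩ := (Submodule.mem_span_set'.1 hx)
  choose U hU using fun i => (g i).2
  refine ⟨m, fun i => f i, U, fun i => (f i).2, fun i => (hU i).1, ?_⟩
  rw [← h]
  refine Finset.sum_congr rfl fun i _ => ?_
  rw [← (hU i).2]; rfl

lemma main_mem (N w : ℕ) (hN : 0 < N) (hw : 0 < w) (A : PArr (Fb Fq)) (hA : A.Positive N)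
    (hAw : A.wt = w) : Li Fq A ∈ Submodule.span (AN Fq N)
      {x | ∃ U : PArr (Fb Fq), (U.Positive N ∧ InTw (qc Fq) w U) ∧ x = Li Fq U} := by
  set W := List.ofFn fun i => (A.s i, A.eps i) with hWdef
  have h1 : PosL N W := by
    intro x hx
    obtain ⟨i, rfl⟩ := (List.mem_ofFn' _ _).1 hx
    exact ⟨hA.1 i, hA.2 i⟩
  have h2 : wl W = w := by
    rw [wl, hWdef, List.map_ofFn, List.sum_ofFn, ← hAw]; rfl
  have h3 : Li Fq A = Li Fq (toArr Fq W) :=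
    tendsto_nhds_unique (tendsto_Li Fq A hA.1) (tendsto_toArr Fq N W h1)
  rw [h3]
  refine induct (cc Fq) (fun W => Li Fq (toArr Fq W)) (cc_mul Fq) (qc Fq) N (two_le_qc Fq)
    (AN Fq N) (cc_key Fq N hN) (fun x y hx hy => by rw [mul_pow, hx, hy, one_mul])
    (tendsto_toArr Fq N) w hw _ ?_ _ W h1 h2 le_rfl
  intro V hV hVw hne hle hlast
  refine Submodule.subset_span ⟨toArr Fq V, ⟨⟨fun i => (hV _ (List.get_mem V i)).1,
    fun i => (hV _ (List.get_mem V i)).2⟩, List.length_pos_iff.2 hne, ?_, ?_, ?_⟩, rfl⟩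
  · rw [← hVw, wl]
    conv_rhs => rw [← List.ofFn_get V, List.map_ofFn, List.sum_ofFn]
    rfl
  · intro i _
    exact hle _ (List.get_mem V i)
  · intro i hi
    rw [List.getLast_eq_getElem] at hlast
    have key : ∀ j : Fin V.length, j.val = V.length - 1 → (V.get j).1 < qc Fq := by
      rintro ⟨j, hj⟩ h
      obtain rfl : j = V.length - 1 := h
      exact hlast
    exact key i hi

end Analysis

/-- **Weak Brown–Deligne theorem for Carlitz multiple polylogarithms at roots of unity**
(Theorem `weak BD CMPL`): every `Li(𝛆;𝔱)` of weight `w` is an `A_N`-linear combination of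
the `Li(𝛜;𝔰)` with `𝔰 ∈ T_w`; in particular the latter span `CL_{N,w}` over `K_N`. -/
theorem weak_brown_deligne_CMPL
    (Fq : Type) [Field Fq] [Fintype Fq] (N w : ℕ) (hN : 0 < N) (hw : 0 < w) :
    (∀ A : PArr (Fb Fq), A.Positive N → A.wt = w →
      ∃ (m : ℕ) (a : Fin m → Kinf Fq) (U : Fin m → PArr (Fb Fq)),
        (∀ i, a i ∈ AN Fq N) ∧ (∀ i, (U i).Positive N ∧ InTw (qc Fq) w (U i)) ∧
        Li Fq A = ∑ i, a i * Li Fq (U i)) ∧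
    Submodule.span (KNf Fq N)
        {x | ∃ U : PArr (Fb Fq), U.Positive N ∧ InTw (qc Fq) w U ∧ x = Li Fq U}
      = CL Fq N w := by
  have main : ∀ A : PArr (Fb Fq), A.Positive N → A.wt = w →
      ∃ (m : ℕ) (a : Fin m → Kinf Fq) (U : Fin m → PArr (Fb Fq)),
        (∀ i, a i ∈ AN Fq N) ∧ (∀ i, (U i).Positive N ∧ InTw (qc Fq) w (U i)) ∧
        Li Fq A = ∑ i, a i * Li Fq (U i) := fun A hA hAw =>
    span_fin (AN Fq N) (Li Fq) (fun U => U.Positive N ∧ InTw (qc Fq) w U) _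
      (main_mem Fq N w hN hw A hA hAw)
  refine ⟨main, le_antisymm (Submodule.span_mono ?_) (Submodule.span_le.2 ?_)⟩
  · rintro x ⟨U, hU, hT, rfl⟩
    exact ⟨U, hU, hT.2.1, rfl⟩
  · rintro x ⟨A, hA, hAw, rfl⟩
    obtain ⟨m, a, U, ha, hU, h⟩ := main A hA hAw
    rw [h]
    refine Submodule.sum_mem _ fun i _ => ?_
    exact Submodule.smul_mem _ (⟨a i, AN_le_KNf Fq N _ (ha i)⟩ : KNf Fq N)
      (Submodule.subset_span ⟨U i, (hU i).1, (hU i).2, rfl⟩)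

end ZHPC
end
end
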